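/- arXiv:1612.01760 — 4 statements merged into one kernel-verified Lean document; each statement's English description precedes it below -/
import Mathlib

section
/- Let g, h ∈ ℤ[x] be nonzero intersective polynomials with deg(g) = deg(h) = 2. Then there exist constants c, C > 0 such that for every integer N ≥ 2 and every set A ⊆ {1,…,N} satisfying a − a' ≠ g(m) + h(n) for all distinct pairs a, a' ∈ A and all integers m, n ≥ 1, one has |A| ≤ C · N · exp(−c·(log N)^{1/2}). -/
/-- A nonzero polynomial `h ∈ ℤ[x]` is *intersective* if for every positive integer `q`
there is a positive integer `n` with `q ∣ h(n)`. -/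
def Intersective (h : Polynomial ℤ) : Prop :=
  h ≠ 0 ∧ ∀ q : ℕ, 0 < q → ∃ n : ℕ, 0 < n ∧ (q : ℤ) ∣ h.eval (n : ℤ)

/-- The additive character `x ↦ exp (2πix)` on the reals. -/
noncomputable def unitExp (x : ℝ) : ℂ := Complex.exp ((2 * Real.pi * x : ℝ) * Complex.I)

lemma unitExp_add (x y : ℝ) : unitExp (x + y) = unitExp x * unitExp y := by
  simp only [unitExp, ← Complex.exp_add]
  congr 1
  push_cast
  ring

@[simp] lemma norm_unitExp (x : ℝ) : ‖unitExp x‖ = 1 := Complex.norm_exp_ofReal_mul_I _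

@[simp] lemma unitExp_zero : unitExp 0 = 1 := by simp [unitExp]

lemma conj_unitExp (x : ℝ) : (starRingEnd ℂ) (unitExp x) = unitExp (-x) := by
  simp only [unitExp, ← Complex.exp_conj]
  congr 1
  rw [map_mul, Complex.conj_ofReal, Complex.conj_I]
  push_cast
  ring

@[simp] lemma unitExp_intCast (n : ℤ) : unitExp n = 1 := by
  rw [unitExp, Complex.exp_eq_one_iff]
  exact ⟨n, by push_cast; ring⟩

lemma unitExp_nat_mul (n : ℕ) (x : ℝ) : unitExp (x * n) = unitExp x ^ n := by
  rw [unitExp, unitExp, ← Complex.exp_nat_mul]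
  congr 1
  push_cast
  ring

lemma norm_unitExp_sub_one_eq (x : ℝ) : ‖unitExp x - 1‖ = 2 * |Real.sin (Real.pi * x)| := by
  rw [unitExp, mul_comm _ Complex.I, Complex.norm_exp_I_mul_ofReal_sub_one, Real.norm_eq_abs,
    abs_mul, abs_two, mul_assoc, mul_div_cancel_left₀ _ two_ne_zero]

lemma norm_unitExp_sub_one_le (x : ℝ) : ‖unitExp x - 1‖ ≤ 2 * Real.pi * |x| := by
  rw [norm_unitExp_sub_one_eq]
  have := Real.abs_sin_le_abs (x := Real.pi * x)
  rw [abs_mul, abs_of_pos Real.pi_pos] at this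
  linarith

lemma norm_unitExp_sub_le (x y : ℝ) : ‖unitExp x - unitExp y‖ ≤ 2 * Real.pi * |x - y| := by
  have : unitExp x - unitExp y = unitExp y * (unitExp (x - y) - 1) := by
    rw [mul_sub, ← unitExp_add]; simp
  rw [this, norm_mul, norm_unitExp, one_mul]
  exact norm_unitExp_sub_one_le _

lemma le_norm_unitExp_sub_one {x κ : ℝ} (h : ∀ n : ℤ, κ ≤ |x - n|) :
    4 * κ ≤ ‖unitExp x - 1‖ := by
  have hx : unitExp x = unitExp (x - round x) := by
    conv_lhs => rw [← sub_add_cancel x (round x : ℝ), unitExp_add, unitExp_intCast, mul_one]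
  rw [hx, norm_unitExp_sub_one_eq]
  set y := x - round x with hy
  have hy1 : |y| ≤ 1 / 2 := abs_sub_round x
  have hκ : κ ≤ |y| := h _
  have h1 : |Real.sin (Real.pi * y)| = Real.sin (Real.pi * |y|) := by
    rw [Real.abs_sin_eq_sin_abs_of_abs_le_pi, abs_mul, abs_of_pos Real.pi_pos]
    rw [abs_mul, abs_of_pos Real.pi_pos]
    nlinarith [Real.pi_pos]
  have h2 := Real.mul_le_sin (x := Real.pi * |y|) (by positivity)
    (by nlinarith [Real.pi_pos])
  have h3 : 2 / Real.pi * (Real.pi * |y|) = 2 * |y| := by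
    field_simp
  rw [h1]
  linarith

lemma norm_sum_unitExp_le_card {ι : Type*} (s : Finset ι) (f : ι → ℝ) :
    ‖∑ i ∈ s, unitExp (f i)‖ ≤ s.card := by
  refine (norm_sum_le _ _).trans ?_
  simp

/-- A geometric progression of phases sums to at most the inverse of twice the distance of its
ratio to the integers. -/
lemma norm_geom_sum_unitExp_le {x κ : ℝ} (hκ : 0 < κ) (h : ∀ n : ℤ, κ ≤ |x - n|) (T : ℕ) :
    ‖∑ t ∈ Finset.range T, unitExp (x * t)‖ ≤ 1 / (2 * κ) := by
  simp only [unitExp_nat_mul]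
  have h1 := le_norm_unitExp_sub_one h
  have h2 : ‖(∑ t ∈ Finset.range T, unitExp x ^ t)‖ * ‖unitExp x - 1‖ ≤ 2 := by
    rw [← norm_mul, geom_sum_mul]
    refine (norm_sub_le _ _).trans ?_
    simp; norm_num
  rw [le_div_iff₀ (by positivity)]
  nlinarith [norm_nonneg (∑ t ∈ Finset.range T, unitExp x ^ t)]

/-- Orthogonality of characters modulo `q`. -/
lemma sum_unitExp_div {q : ℕ} (hq : 0 < q) (n : ℤ) :
    ∑ j ∈ Finset.range q, unitExp ((j : ℝ) / q * n) = if (q : ℤ) ∣ n then (q : ℂ) else 0 := by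
  have hq' : (q : ℝ) ≠ 0 := by positivity
  have hrw : ∀ j : ℕ, unitExp ((j : ℝ) / q * n) = unitExp ((n : ℝ) / q) ^ j := by
    intro j
    rw [← unitExp_nat_mul]
    congr 1
    ring
  simp only [hrw]
  split_ifs with hd
  · obtain ⟨k, rfl⟩ := hd
    have : ((((q : ℤ) * k : ℤ) : ℝ) / q) = (k : ℤ) := by
      push_cast; field_simp
    rw [this]
    simp
  · have hne : unitExp ((n : ℝ) / q) ≠ 1 := by
      intro h1
      rw [unitExp, Complex.exp_eq_one_iff] at h1
      obtain ⟨k, hk⟩ := h1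
      apply hd
      refine ⟨k, ?_⟩
      have h2 : (2 * Real.pi * ((n : ℝ) / q) : ℝ) = k * (2 * Real.pi) := by
        have h3 : ((2 * Real.pi * ((n : ℝ) / q) : ℝ) : ℂ) * Complex.I
            = ((k * (2 * Real.pi) : ℝ) : ℂ) * Complex.I := by
          rw [hk]; push_cast; ring
        exact_mod_cast mul_right_cancel₀ Complex.I_ne_zero h3
      have h4 : (n : ℝ) / q = k := by
        have := Real.pi_pos
        nlinarith [mul_left_cancel₀ (two_ne_zero' ℝ) (mul_left_cancel₀ this.ne'
          (show Real.pi * (2 * ((n : ℝ) / q)) = Real.pi * (2 * k) by linarith))]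
      rw [div_eq_iff hq'] at h4
      have : (n : ℝ) = ((q * k : ℤ) : ℝ) := by push_cast; linarith
      exact_mod_cast this
    have h5 := geom_sum_mul (unitExp ((n : ℝ) / q)) q
    have h6 : unitExp ((n : ℝ) / q) ^ q = 1 := by
      rw [← unitExp_nat_mul, div_mul_cancel₀ _ hq', unitExp_intCast]
    rw [h6, sub_self] at h5
    exact (mul_eq_zero.mp h5).resolve_right (sub_ne_zero.mpr hne)

lemma norm_sum_shift_sub_le (f : ℕ → ℂ) (hf : ∀ t, ‖f t‖ ≤ 1) (T j : ℕ) :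
    ‖∑ t ∈ Finset.range T, f (t + j) - ∑ t ∈ Finset.range T, f t‖ ≤ 2 * j := by
  have h1 := Finset.sum_range_add f T j
  have h2 := Finset.sum_range_add f j T
  rw [add_comm j T, h1] at h2
  have h3 : ∑ t ∈ Finset.range T, f (t + j) - ∑ t ∈ Finset.range T, f t
      = ∑ i ∈ Finset.range j, f (T + i) - ∑ i ∈ Finset.range j, f i := by
    simp only [add_comm _ j]
    linear_combination -h2
  have h4 : ∀ g : ℕ → ℂ, (∀ t, ‖g t‖ ≤ 1) → ‖∑ i ∈ Finset.range j, g i‖ ≤ j := by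
    intro g hg
    refine (norm_sum_le _ _).trans ((Finset.sum_le_sum fun i _ => hg i).trans ?_)
    simp
  rw [h3]
  refine (norm_sub_le _ _).trans ?_
  linarith [h4 _ hf, h4 (fun i => f (T + i)) fun i => hf _]

lemma sq_norm_sum_unitExp (s : Finset ℕ) (f : ℕ → ℝ) :
    ((‖∑ j ∈ s, unitExp (f j)‖ ^ 2 : ℝ) : ℂ)
      = ∑ j ∈ s, ∑ k ∈ s, unitExp (f j - f k) := by
  rw [Complex.ofReal_pow, ← Complex.mul_conj', map_sum, Finset.sum_mul_sum]
  refine Finset.sum_congr rfl fun j _ => Finset.sum_congr rfl fun k _ => ?_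
  rw [conj_unitExp, ← unitExp_add, sub_eq_add_neg]

/-- Van der Corput's inequality with differencing parameter `H`. -/
lemma van_der_corput (P : ℕ → ℝ) (T H : ℕ) :
    (H : ℝ) ^ 2 * ‖∑ t ∈ Finset.range T, unitExp (P t)‖ ^ 2 ≤
      2 * T * (∑ j ∈ Finset.range H, ∑ k ∈ Finset.range H,
        ‖∑ t ∈ Finset.range T, unitExp (P (t + j) - P (t + k))‖) + 2 * (H : ℝ) ^ 4 := by
  set S := ∑ t ∈ Finset.range T, unitExp (P t) with hS
  set V : ℕ → ℂ := fun t => ∑ j ∈ Finset.range H, unitExp (P (t + j)) with hV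
  have h1 : ‖(H : ℂ) * S‖ ≤ ‖∑ t ∈ Finset.range T, V t‖ + (H : ℝ) ^ 2 := by
    have h2 : ∑ t ∈ Finset.range T, V t
        = ∑ j ∈ Finset.range H, ∑ t ∈ Finset.range T, unitExp (P (t + j)) := Finset.sum_comm
    have h3 : ∑ t ∈ Finset.range T, V t - (H : ℂ) * S = ∑ j ∈ Finset.range H,
        (∑ t ∈ Finset.range T, unitExp (P (t + j)) - S) := by
      rw [Finset.sum_sub_distrib, h2]; simp
    have h4 : ‖∑ t ∈ Finset.range T, V t - (H : ℂ) * S‖ ≤ (H : ℝ) ^ 2 := by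
      rw [h3]
      refine (norm_sum_le _ _).trans ((Finset.sum_le_sum fun j _ =>
        norm_sum_shift_sub_le (fun t => unitExp (P t)) (by simp) T j).trans ?_)
      rw [← Finset.mul_sum, ← Nat.cast_sum]
      have h5 := Finset.sum_range_id_mul_two H
      have h6 : (∑ i ∈ Finset.range H, i) * 2 ≤ H ^ 2 := by
        rw [h5, sq]; exact Nat.mul_le_mul_left _ (Nat.sub_le _ _)
      have h7 : (((∑ i ∈ Finset.range H, i) * 2 : ℕ) : ℝ) ≤ ((H ^ 2 : ℕ) : ℝ) := by
        exact_mod_cast h6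
      push_cast at h7 ⊢
      linarith
    have h5 := norm_sub_norm_le ((H : ℂ) * S) (∑ t ∈ Finset.range T, V t)
    rw [norm_sub_rev] at h5
    linarith
  have h2 : ‖∑ t ∈ Finset.range T, V t‖ ^ 2 ≤ T * ∑ t ∈ Finset.range T, ‖V t‖ ^ 2 := by
    have h3 : ‖∑ t ∈ Finset.range T, V t‖ ^ 2 ≤ (∑ t ∈ Finset.range T, ‖V t‖) ^ 2 := by
      gcongr; exact norm_sum_le _ _
    refine h3.trans ?_
    have := sq_sum_le_card_mul_sum_sq (s := Finset.range T) (f := fun t => ‖V t‖)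
    simpa using this
  have h3 : ∑ t ∈ Finset.range T, ‖V t‖ ^ 2 ≤ ∑ j ∈ Finset.range H, ∑ k ∈ Finset.range H,
        ‖∑ t ∈ Finset.range T, unitExp (P (t + j) - P (t + k))‖ := by
    have h4 : ((∑ t ∈ Finset.range T, ‖V t‖ ^ 2 : ℝ) : ℂ) = ∑ j ∈ Finset.range H,
        ∑ k ∈ Finset.range H, ∑ t ∈ Finset.range T, unitExp (P (t + j) - P (t + k)) := by
      rw [Complex.ofReal_sum]
      have : ∀ t, ((‖V t‖ ^ 2 : ℝ) : ℂ) = ∑ j ∈ Finset.range H, ∑ k ∈ Finset.range H,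
          unitExp (P (t + j) - P (t + k)) := fun t =>
        sq_norm_sum_unitExp (Finset.range H) fun j => P (t + j)
      simp only [this]
      rw [Finset.sum_comm]
      exact Finset.sum_congr rfl fun j _ => Finset.sum_comm
    have h5 : (∑ t ∈ Finset.range T, ‖V t‖ ^ 2 : ℝ)
        ≤ ‖((∑ t ∈ Finset.range T, ‖V t‖ ^ 2 : ℝ) : ℂ)‖ := by
      rw [Complex.norm_real]; exact le_abs_self _
    rw [h4] at h5
    exact h5.trans ((norm_sum_le _ _).trans (Finset.sum_le_sum fun j _ => norm_sum_le _ _))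
  have h4 : ‖(H : ℂ) * S‖ ^ 2
      ≤ 2 * ‖∑ t ∈ Finset.range T, V t‖ ^ 2 + 2 * ((H : ℝ) ^ 2) ^ 2 := by
    have := pow_le_pow_left₀ (norm_nonneg _) h1 2
    nlinarith [sq_nonneg (‖∑ t ∈ Finset.range T, V t‖ - (H : ℝ) ^ 2)]
  rw [norm_mul, mul_pow, Complex.norm_natCast] at h4
  have h5 := mul_le_mul_of_nonneg_left h3 (Nat.cast_nonneg (α := ℝ) T)
  nlinarith

lemma quadratic_van_der_corput (θ φ : ℝ) (T H : ℕ) :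
    (H : ℝ) ^ 2 * ‖∑ t ∈ Finset.range T, unitExp (θ * t ^ 2 + φ * t)‖ ^ 2 ≤
      2 * T * (∑ j ∈ Finset.range H, ∑ k ∈ Finset.range H,
        ‖∑ t ∈ Finset.range T, unitExp (2 * θ * (j - k) * t)‖) + 2 * (H : ℝ) ^ 4 := by
  refine (van_der_corput (fun t => θ * t ^ 2 + φ * t) T H).trans (le_of_eq ?_)
  congr 2
  refine Finset.sum_congr rfl fun j _ => Finset.sum_congr rfl fun k _ => ?_
  have : ∀ t : ℕ, unitExp (θ * (t + j : ℕ) ^ 2 + φ * (t + j : ℕ)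
      - (θ * (t + k : ℕ) ^ 2 + φ * (t + k : ℕ)))
      = unitExp (θ * (j ^ 2 - k ^ 2) + φ * (j - k)) * unitExp (2 * θ * (j - k) * t) := by
    intro t
    rw [← unitExp_add]
    congr 1
    push_cast
    ring
  simp only [this]
  rw [← Finset.mul_sum, norm_mul, norm_unitExp, one_mul]

section RationalApproximation

variable {c : ℤ} {c₀ H m : ℕ} {a : ℤ} {θ : ℝ}

/-- Differenced phases away from the resonant frequencies. -/
lemma norm_sum_le_of_not_dvd (hc₀ : |c| ≤ c₀) (hH : 0 < H) (hm : 0 < m) (ham : IsCoprime a m)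
    (hθ : |θ - a / m| ≤ 1 / (4 * c₀ * H * m)) {k : ℤ} (hk : |k| ≤ H)
    (hdvd : ¬ (m : ℤ) ∣ 2 * c * k) (T : ℕ) :
    ‖∑ t ∈ Finset.range T, unitExp (2 * (c * θ) * k * t)‖ ≤ m := by
  have hm' : (0 : ℝ) < m := by exact_mod_cast hm
  have hH' : (0 : ℝ) < H := by exact_mod_cast hH
  have hc0 : c ≠ 0 := by rintro rfl; simp at hdvd
  have hcpos : (0 : ℝ) < c₀ := by
    have : 0 < |c| := abs_pos.mpr hc0
    exact_mod_cast this.trans_le hc₀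
  have hcR : |(c : ℝ)| ≤ c₀ := by exact_mod_cast hc₀
  have hkR : |(k : ℝ)| ≤ H := by exact_mod_cast hk
  have key : ∀ n : ℤ, 1 / (2 * (m : ℝ)) ≤ |2 * (c * θ) * k - n| := by
    intro n
    have h1 : 2 * (c * θ) * k - n = ((2 * c * k * a - n * m : ℤ) : ℝ) / m
        + 2 * c * k * (θ - a / m) := by
      push_cast; field_simp; ring
    have h2 : (1 : ℝ) ≤ |((2 * c * k * a - n * m : ℤ) : ℝ)| := by
      rw [← Int.cast_abs]
      have : (2 * c * k * a - n * m : ℤ) ≠ 0 := by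
        intro h0
        apply hdvd
        apply ham.symm.dvd_of_dvd_mul_right
        exact ⟨n, by linarith⟩
      exact_mod_cast Int.one_le_abs this
    have h3 : |2 * c * k * (θ - a / m)| ≤ 1 / (2 * (m : ℝ)) := by
      rw [abs_mul, abs_mul, abs_mul, abs_two]
      calc 2 * |(c : ℝ)| * |(k : ℝ)| * |θ - a / m| ≤ 2 * c₀ * H * (1 / (4 * c₀ * H * m)) := by
            gcongr
        _ = 1 / (2 * (m : ℝ)) := by field_simp; norm_num
    have h4 : 1 / (m : ℝ) ≤ |((2 * c * k * a - n * m : ℤ) : ℝ) / m| := by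
      rw [abs_div, abs_of_pos hm']
      gcongr
    have h5 : 1 / (m : ℝ) = 1 / (2 * (m : ℝ)) + 1 / (2 * (m : ℝ)) := by field_simp; norm_num
    rw [h1]
    have h6 := abs_sub_abs_le_abs_sub (((2 * c * k * a - n * m : ℤ) : ℝ) / m)
      (-(2 * c * k * (θ - a / m)))
    rw [abs_neg, sub_neg_eq_add] at h6
    linarith
  refine (norm_geom_sum_unitExp_le (by positivity) key T).trans (le_of_eq ?_)
  field_simp

/-- Differenced phases at any nonzero frequency, in terms of the error of the rational
approximation. -/
lemma norm_sum_le_add_inv (hc : c ≠ 0) (hc₀ : |c| ≤ c₀) (hH : 0 < H) (hm : 0 < m)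
    (ham : IsCoprime a m) (hθ : |θ - a / m| ≤ 1 / (4 * c₀ * H * m)) {κ : ℝ} (hκ : 0 < κ) {k : ℤ}
    (hk : |k| ≤ H) (hκk : κ ≤ 2 * |(k : ℝ)| * |θ - a / m|) (T : ℕ) :
    ‖∑ t ∈ Finset.range T, unitExp (2 * (c * θ) * k * t)‖ ≤ m + 1 / (2 * κ) := by
  by_cases hdvd : (m : ℤ) ∣ 2 * c * k
  swap
  · have := norm_sum_le_of_not_dvd hc₀ hH hm ham hθ hk hdvd T
    have : 0 < 1 / (2 * κ) := by positivity
    linarith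
  have hm' : (0 : ℝ) < m := by exact_mod_cast hm
  have hH' : (0 : ℝ) < H := by exact_mod_cast hH
  have hcpos : (0 : ℝ) < c₀ := by
    have : 0 < |c| := abs_pos.mpr hc
    exact_mod_cast this.trans_le hc₀
  have hcR : |(c : ℝ)| ≤ c₀ := by exact_mod_cast hc₀
  have hc1 : 1 ≤ |(c : ℝ)| := by exact_mod_cast Int.one_le_abs hc
  have hkR : |(k : ℝ)| ≤ H := by exact_mod_cast hk
  obtain ⟨l, hl⟩ := hdvd
  have hl' : (2 * c * k : ℝ) = m * l := by exact_mod_cast hl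
  have hx : 2 * (c * θ) * k = ((l * a : ℤ) : ℝ) + 2 * c * k * (θ - a / m) := by
    have h1 : 2 * (c : ℝ) * k * (a / m) = l * a := by
      rw [hl']; field_simp
    push_cast
    linear_combination h1
  have h3 : |2 * c * k * (θ - a / m)| ≤ 1 / 2 := by
    rw [abs_mul, abs_mul, abs_mul, abs_two]
    calc 2 * |(c : ℝ)| * |(k : ℝ)| * |θ - a / m| ≤ 2 * c₀ * H * (1 / (4 * c₀ * H * m)) := by
          gcongr
      _ = 1 / 2 * (1 / m) := by field_simp; norm_num
      _ ≤ 1 / 2 * 1 := by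
          gcongr
          rw [div_le_one hm']
          exact_mod_cast hm
      _ = 1 / 2 := by norm_num
  have h4 : κ ≤ |2 * c * k * (θ - a / m)| := by
    rw [abs_mul, abs_mul, abs_mul, abs_two]
    calc κ ≤ 2 * 1 * |(k : ℝ)| * |θ - a / m| := by linarith
      _ ≤ 2 * |(c : ℝ)| * |(k : ℝ)| * |θ - a / m| := by gcongr
  have key : ∀ n : ℤ, κ ≤ |2 * (c * θ) * k - n| := by
    intro n
    rw [hx]
    by_cases hn : n = l * a
    · rw [hn]; simpa using h4
    · have h5 : (1 : ℝ) ≤ |((l * a - n : ℤ) : ℝ)| := by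
        exact_mod_cast Int.one_le_abs (sub_ne_zero.mpr (Ne.symm hn))
      have h6 := abs_sub_abs_le_abs_sub ((l * a - n : ℤ) : ℝ) (-(2 * c * k * (θ - a / m)))
      rw [abs_neg, sub_neg_eq_add] at h6
      have h7 : ((l * a : ℤ) : ℝ) + 2 * c * k * (θ - a / m) - n
          = ((l * a - n : ℤ) : ℝ) + 2 * c * k * (θ - a / m) := by push_cast; ring
      rw [h7]
      linarith
  have := norm_geom_sum_unitExp_le hκ key T
  linarith

end RationalApproximation

/-- The number of resonant frequencies. -/
lemma card_filter_dvd_le {c : ℤ} {c₀ m : ℕ} (hc : c ≠ 0) (hc₀ : |c| ≤ c₀) (hm : 0 < m)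
    (H j : ℕ) :
    (((Finset.range H).filter fun k : ℕ => (m : ℤ) ∣ 2 * c * ((j : ℤ) - k)).card : ℝ)
      ≤ 2 * c₀ * H / m + 1 := by
  set g := Nat.gcd m (2 * c).natAbs with hg
  have hgpos : 0 < g := Nat.gcd_pos_of_pos_left _ hm
  obtain ⟨m₁, hm₁⟩ : g ∣ m := Nat.gcd_dvd_left _ _
  have hm₁pos : 0 < m₁ := Nat.pos_of_ne_zero (by rintro rfl; omega)
  have hgle : (g : ℝ) ≤ 2 * c₀ := by
    have h1 : g ≤ (2 * c).natAbs := Nat.gcd_le_right _ (by omega)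
    have h2 : (2 * c).natAbs ≤ 2 * c₀ := by
      rw [Int.natAbs_mul]
      rw [Int.abs_eq_natAbs] at hc₀
      exact Nat.mul_le_mul_left 2 (by exact_mod_cast hc₀)
    exact_mod_cast h1.trans h2
  have hsub : ((Finset.range H).filter fun k : ℕ => (m : ℤ) ∣ 2 * c * ((j : ℤ) - k))
      ⊆ (Finset.range H).filter fun k : ℕ => k ≡ j [MOD m₁] := by
    intro k hk
    simp only [Finset.mem_filter] at hk ⊢
    refine ⟨hk.1, ?_⟩
    rw [Nat.modEq_iff_dvd]
    have h1 : m ∣ (2 * c).natAbs * ((j : ℤ) - k).natAbs := by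
      rw [← Int.natAbs_mul]; exact Int.natCast_dvd.mp hk.2
    have h2 : m / g ∣ ((j : ℤ) - k).natAbs :=
      (Nat.coprime_div_gcd_div_gcd hgpos).dvd_of_dvd_mul_left (by
        have h3 : g ∣ (2 * c).natAbs := Nat.gcd_dvd_right _ _
        rw [← Nat.mul_dvd_mul_iff_left hgpos, ← mul_assoc, Nat.mul_div_cancel' h3,
          Nat.mul_div_cancel' (Nat.gcd_dvd_left _ _)]
        exact h1)
    rw [hm₁, Nat.mul_div_cancel_left _ hgpos] at h2
    exact Int.natCast_dvd.mpr h2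
  have hcount : ((Finset.range H).filter fun k : ℕ => k ≡ j [MOD m₁]).card ≤ H / m₁ + 1 := by
    rw [← Nat.count_eq_card_filter_range, Nat.count_modEq_card _ hm₁pos]
    split_ifs <;> omega
  have h1 : ((H / m₁ : ℕ) : ℝ) ≤ 2 * c₀ * H / m := by
    refine Nat.cast_div_le.trans ?_
    have hmR : (m : ℝ) = g * m₁ := by exact_mod_cast hm₁
    have hgR : (0 : ℝ) < g := by exact_mod_cast hgpos
    have hm₁R : (0 : ℝ) < m₁ := by exact_mod_cast hm₁pos
    rw [hmR, div_le_div_iff₀ hm₁R (by positivity)]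
    calc (H : ℝ) * (g * m₁) = g * (H * m₁) := by ring
      _ ≤ 2 * c₀ * (H * m₁) := by gcongr
      _ = 2 * c₀ * H * m₁ := by ring
  have h2 := (Finset.card_le_card hsub).trans hcount
  have h3 : (((Finset.range H).filter fun k : ℕ => (m : ℤ) ∣ 2 * c * ((j : ℤ) - k)).card : ℝ)
      ≤ ((H / m₁ + 1 : ℕ) : ℝ) := by exact_mod_cast h2
  push_cast at h3
  linarith

lemma abs_natCast_sub_natCast_le {H j k : ℕ} (hj : j ∈ Finset.range H) (hk : k ∈ Finset.range H) :
    |(j : ℤ) - k| ≤ H := by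
  rw [Finset.mem_range] at hj hk
  rw [abs_le]
  constructor <;> omega

lemma sq_le_of_mul_le {c H T ε : ℝ} (hc : 1 ≤ c) (hH : 0 ≤ H) (hT : 0 ≤ T) (hε : 0 < ε)
    (hε1 : ε ≤ 1) (h : 40 * c * H ≤ ε ^ 2 * T) : H ^ 2 ≤ ε ^ 2 * T ^ 2 / 1600 := by
  have h1 : 40 * H ≤ 40 * c * H := by nlinarith
  have h2 : ε ^ 2 * T ≤ ε * T := by
    apply mul_le_mul_of_nonneg_right _ hT
    nlinarith
  have h3 := pow_le_pow_left₀ (by positivity) (h1.trans (h.trans h2)) 2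
  linarith [mul_pow ε T 2, mul_pow 40 H 2]

/-- A large quadratic exponential sum has a small denominator. -/
lemma sq_norm_quadratic_sum_le {c : ℤ} {c₀ H m T : ℕ} {a : ℤ} {θ φ ε : ℝ} (hc : c ≠ 0)
    (hc₀ : |c| ≤ c₀) (hH : 0 < H) (hm : 0 < m) (ham : IsCoprime a m)
    (hθ : |θ - a / m| ≤ 1 / (4 * c₀ * H * m)) (hε : 0 < ε) (hε1 : ε ≤ 1)
    (hHT : 40 * c₀ * H ≤ ε ^ 2 * T) (hmH : m ≤ 4 * c₀ * H)
    (hS : ε * T ≤ ‖∑ t ∈ Finset.range T, unitExp ((c * θ) * t ^ 2 + φ * t)‖) :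
    ‖∑ t ∈ Finset.range T, unitExp ((c * θ) * t ^ 2 + φ * t)‖ ^ 2 ≤ 16 * c₀ * T ^ 2 / m := by
  set S := ‖∑ t ∈ Finset.range T, unitExp ((c * θ) * t ^ 2 + φ * t)‖ with hSdef
  have hm' : (0 : ℝ) < m := by exact_mod_cast hm
  have hH' : (0 : ℝ) < H := by exact_mod_cast hH
  have hc₀1 : (1 : ℝ) ≤ c₀ := by exact_mod_cast (Int.one_le_abs hc).trans hc₀
  have hmH' : (m : ℝ) ≤ 4 * c₀ * H := by exact_mod_cast hmH
  have hT0 : (0 : ℝ) ≤ T := Nat.cast_nonneg T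
  have h1 := quadratic_van_der_corput (c * θ) φ T H
  rw [← hSdef] at h1
  have h2 : ∑ j ∈ Finset.range H, ∑ k ∈ Finset.range H,
      ‖∑ t ∈ Finset.range T, unitExp (2 * (c * θ) * (j - k) * t)‖
      ≤ (H : ℝ) ^ 2 * m + T * (H * (2 * c₀ * H / m + 1)) := by
    have h3 : ∀ j ∈ Finset.range H, ∑ k ∈ Finset.range H,
        ‖∑ t ∈ Finset.range T, unitExp (2 * (c * θ) * (j - k) * t)‖
        ≤ H * m + T * (2 * c₀ * H / m + 1) := by
      intro j hj
      have h4 : ∀ k ∈ Finset.range H,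
          ‖∑ t ∈ Finset.range T, unitExp (2 * (c * θ) * (j - k) * t)‖
          ≤ m + T * if (m : ℤ) ∣ 2 * c * ((j : ℤ) - k) then 1 else 0 := by
        intro k hk
        split_ifs with hd
        · have := norm_sum_unitExp_le_card (Finset.range T)
            fun t : ℕ => 2 * (c * θ) * (j - k) * t
          rw [Finset.card_range] at this
          linarith
        · have := norm_sum_le_of_not_dvd hc₀ hH hm ham hθ
            (abs_natCast_sub_natCast_le hj hk) hd T
          push_cast at this
          linarith
      refine (Finset.sum_le_sum h4).trans ?_
      rw [Finset.sum_add_distrib, ← Finset.mul_sum, Finset.sum_boole]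
      simp only [Finset.sum_const, Finset.card_range, nsmul_eq_mul]
      have := card_filter_dvd_le hc hc₀ hm H j
      gcongr
    refine (Finset.sum_le_sum h3).trans (le_of_eq ?_)
    simp only [Finset.sum_const, Finset.card_range, nsmul_eq_mul]
    ring
  have h3 : (1 : ℝ) ≤ 4 * c₀ * H / m := by rwa [one_le_div hm']
  have h4 : (H : ℝ) ^ 2 * m + T * (H * (2 * c₀ * H / m + 1))
      ≤ H ^ 2 * (4 * c₀ * H + 6 * c₀ * T / m) := by
    have : (H : ℝ) ^ 2 * (4 * c₀ * H + 6 * c₀ * T / m) - ((H : ℝ) ^ 2 * m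
        + T * (H * (2 * c₀ * H / m + 1)))
        = H ^ 2 * (4 * c₀ * H - m) + T * H * (4 * c₀ * H / m - 1) := by
      field_simp; ring
    have h5 : 0 ≤ (H : ℝ) ^ 2 * (4 * c₀ * H - m) := by
      apply mul_nonneg (by positivity); linarith
    have h6 : 0 ≤ (T : ℝ) * H * (4 * c₀ * H / m - 1) := by
      apply mul_nonneg (by positivity); linarith
    linarith
  have h5 : (H : ℝ) ^ 2 * S ^ 2
      ≤ H ^ 2 * (2 * T * (4 * c₀ * H + 6 * c₀ * T / m) + 2 * H ^ 2) := by
    have := mul_le_mul_of_nonneg_left (h2.trans h4) (show (0 : ℝ) ≤ 2 * T by positivity)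
    nlinarith
  have h6 := le_of_mul_le_mul_left h5 (by positivity)
  have h8 := sq_le_of_mul_le hc₀1 hH'.le hT0 hε hε1 hHT
  have h9 : ε ^ 2 * T ^ 2 ≤ S ^ 2 := by
    rw [← mul_pow]; gcongr
  have h10 : (T : ℝ) * (40 * c₀ * H) ≤ T * (ε ^ 2 * T) := by gcongr
  have h11 : 2 * (T : ℝ) * (6 * c₀ * T / m) = 3 / 4 * (16 * c₀ * T ^ 2 / m) := by ring
  nlinarith

/-- A large quadratic exponential sum forces a good rational approximation. -/
lemma abs_sub_le_of_quadratic_sum {c : ℤ} {c₀ H m T : ℕ} {a : ℤ} {θ φ ε : ℝ} (hc : c ≠ 0)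
    (hc₀ : |c| ≤ c₀) (hm : 0 < m) (ham : IsCoprime a m)
    (hθ : |θ - a / m| ≤ 1 / (4 * c₀ * H * m)) (hε : 0 < ε) (hε1 : ε ≤ 1)
    (hHT : 40 * c₀ * H ≤ ε ^ 2 * T) (hTH : ε ^ 2 * T ≤ 80 * c₀ * H) (hHε : 16 ≤ ε ^ 2 * H)
    (hmH : m ≤ 4 * c₀ * H)
    (hS : ε * T ≤ ‖∑ t ∈ Finset.range T, unitExp ((c * θ) * t ^ 2 + φ * t)‖) :
    |θ - a / m| ≤ 1760 * c₀ / (ε ^ 6 * T ^ 2) := by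
  by_cases hβ0 : |θ - a / m| = 0
  · rw [hβ0]; positivity
  have hβ : 0 < |θ - a / m| := lt_of_le_of_ne (abs_nonneg _) (Ne.symm hβ0)
  set β := |θ - a / m| with hβdef
  set S := ‖∑ t ∈ Finset.range T, unitExp ((c * θ) * t ^ 2 + φ * t)‖ with hSdef
  have hH' : (0 : ℝ) < H := by
    by_contra h0
    have : (H : ℝ) = 0 := le_antisymm (not_lt.mp h0) (Nat.cast_nonneg H)
    rw [this] at hHε; norm_num at hHε
  have hH : 0 < H := by exact_mod_cast hH'
  have hm' : (0 : ℝ) < m := by exact_mod_cast hm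
  have hc₀1 : (1 : ℝ) ≤ c₀ := by exact_mod_cast (Int.one_le_abs hc).trans hc₀
  have hmH' : (m : ℝ) ≤ 4 * c₀ * H := by exact_mod_cast hmH
  have hT0 : (0 : ℝ) < T := by
    by_contra h0
    have : (T : ℝ) = 0 := le_antisymm (not_lt.mp h0) (Nat.cast_nonneg T)
    rw [this] at hHT
    have : (0 : ℝ) < 40 * c₀ * H := by positivity
    linarith
  set L := ⌊ε ^ 2 / 16 * H⌋₊ with hL
  have hL1 : (L : ℝ) ≤ ε ^ 2 / 16 * H := Nat.floor_le (by positivity)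
  have hL2 : ε ^ 2 / 16 * H ≤ (L : ℝ) + 1 := (Nat.lt_floor_add_one _).le
  have h1 := quadratic_van_der_corput (c * θ) φ T H
  rw [← hSdef] at h1
  have h2 : ∑ j ∈ Finset.range H, ∑ k ∈ Finset.range H,
      ‖∑ t ∈ Finset.range T, unitExp (2 * (c * θ) * (j - k) * t)‖
      ≤ H * (H * (m + 4 / (ε ^ 2 * H * β)) + T * (2 * L + 1)) := by
    have h3 : ∀ j ∈ Finset.range H, ∑ k ∈ Finset.range H,
        ‖∑ t ∈ Finset.range T, unitExp (2 * (c * θ) * (j - k) * t)‖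
        ≤ H * (m + 4 / (ε ^ 2 * H * β)) + T * (2 * L + 1) := by
      intro j hj
      have h4 : ∀ k ∈ Finset.range H,
          ‖∑ t ∈ Finset.range T, unitExp (2 * (c * θ) * (j - k) * t)‖
          ≤ (m + 4 / (ε ^ 2 * H * β)) + T * if |(j : ℤ) - k| ≤ L then 1 else 0 := by
        intro k hk
        have hpos : 0 < 4 / (ε ^ 2 * H * β) := by positivity
        split_ifs with hd
        · have := norm_sum_unitExp_le_card (Finset.range T)
            fun t : ℕ => 2 * (c * θ) * (j - k) * t
          rw [Finset.card_range] at this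
          linarith
        · have h5 : (L : ℝ) + 1 ≤ |(((j : ℤ) - k : ℤ) : ℝ)| := by
            rw [not_le] at hd
            exact_mod_cast hd
          have := norm_sum_le_add_inv hc hc₀ hH hm ham hθ
            (κ := ε ^ 2 * H * β / 8) (by positivity) (abs_natCast_sub_natCast_le hj hk)
            (by
              rw [← hβdef]
              calc ε ^ 2 * H * β / 8 = 2 * (ε ^ 2 / 16 * H) * β := by ring
                _ ≤ 2 * |(((j : ℤ) - k : ℤ) : ℝ)| * β := by gcongr; linarith) T
          have h6 : 1 / (2 * (ε ^ 2 * H * β / 8)) = 4 / (ε ^ 2 * H * β) := by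
            field_simp; norm_num
          rw [h6] at this
          push_cast at this
          linarith
      refine (Finset.sum_le_sum h4).trans ?_
      rw [Finset.sum_add_distrib, ← Finset.mul_sum, Finset.sum_boole]
      simp only [Finset.sum_const, Finset.card_range, nsmul_eq_mul]
      have hcard : ((Finset.range H).filter fun k : ℕ => |(j : ℤ) - k| ≤ L).card ≤ 2 * L + 1 := by
        have hsub : ((Finset.range H).filter fun k : ℕ => |(j : ℤ) - k| ≤ L)
            ⊆ Finset.Icc (j - L) (j + L) := by
          intro k hk
          simp only [Finset.mem_filter, Finset.mem_Icc, abs_le] at hk ⊢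
          omega
        refine (Finset.card_le_card hsub).trans ?_
        rw [Nat.card_Icc]
        omega
      have : (((Finset.range H).filter fun k : ℕ => |(j : ℤ) - k| ≤ L).card : ℝ)
          ≤ 2 * L + 1 := by exact_mod_cast hcard
      gcongr
    refine (Finset.sum_le_sum h3).trans (le_of_eq ?_)
    simp only [Finset.sum_const, Finset.card_range, nsmul_eq_mul]
  have h3 : H * (H * (m + 4 / (ε ^ 2 * H * β)) + T * (2 * L + 1))
      ≤ (H : ℝ) ^ 2 * (4 * c₀ * H + 4 / (ε ^ 2 * H * β) + T * (3 * ε ^ 2 / 16)) := by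
    have h4 : (2 * L + 1 : ℝ) ≤ H * (3 * ε ^ 2 / 16) := by nlinarith
    calc (H * (H * (m + 4 / (ε ^ 2 * H * β)) + T * (2 * L + 1)) : ℝ)
        ≤ H * (H * (4 * c₀ * H + 4 / (ε ^ 2 * H * β)) + T * (H * (3 * ε ^ 2 / 16))) := by gcongr
      _ = _ := by ring
  have h5 : (H : ℝ) ^ 2 * S ^ 2
      ≤ H ^ 2 * (2 * T * (4 * c₀ * H + 4 / (ε ^ 2 * H * β) + T * (3 * ε ^ 2 / 16)) + 2 * H ^ 2) := by
    have := mul_le_mul_of_nonneg_left (h2.trans h3) (show (0 : ℝ) ≤ 2 * T by positivity)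
    nlinarith
  have h6 := le_of_mul_le_mul_left h5 (by positivity)
  have h8 := sq_le_of_mul_le hc₀1 hH'.le hT0.le hε hε1 hHT
  have h9 : ε ^ 2 * T ^ 2 ≤ S ^ 2 := by
    rw [← mul_pow]; gcongr
  have h10 : (T : ℝ) * (40 * c₀ * H) ≤ T * (ε ^ 2 * T) := by gcongr
  have h11 : 2 / 5 * (ε ^ 2 * T ^ 2) ≤ 2 * T * (4 / (ε ^ 2 * H * β)) := by
    have h12 : 2 * T * (4 * c₀ * H + 4 / (ε ^ 2 * H * β) + T * (3 * ε ^ 2 / 16))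
        = 1 / 5 * (T * (40 * c₀ * H)) + 2 * T * (4 / (ε ^ 2 * H * β))
          + 3 / 8 * (ε ^ 2 * T ^ 2) := by ring
    have h13 : (T : ℝ) * (ε ^ 2 * T) = ε ^ 2 * T ^ 2 := by ring
    have h14 : 0 < ε ^ 2 * (T : ℝ) ^ 2 := by positivity
    linarith
  have h12 : 2 / 5 * (ε ^ 2 * T ^ 2) * (ε ^ 2 * H * β) ≤ 8 * T := by
    have : 2 * T * (4 / (ε ^ 2 * H * β)) * (ε ^ 2 * H * β) = 8 * T := by field_simp; norm_num
    rw [← this]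
    gcongr
  have h13 : T * (ε ^ 4 * T * H * β) ≤ T * 20 := by linarith
  have h14 := le_of_mul_le_mul_left h13 hT0
  rw [le_div_iff₀ (by positivity)]
  have h15 : (ε ^ 2 * T) * (ε ^ 4 * T * β) ≤ 80 * c₀ * H * (ε ^ 4 * T * β) := by gcongr
  nlinarith

/-- Translating the summation variable by the denominator of the leading coefficient shows that a
large sum has a resonant linear coefficient. -/
lemma norm_sum_mul_le_of_not_dvd {c b a : ℤ} {c₀ d m T : ℕ} {α B : ℝ} (hc₀ : |c| ≤ c₀)
    (hd : 0 < d) (hm : 0 < m) (hmT : m ≤ T) (hb : |b| ≤ c₀ * d * T) (hB : 0 ≤ B)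
    (hα : |α - a / (m * d ^ 2)| ≤ B / (T ^ 2 * d ^ 2)) (hdvd : ¬ (d : ℤ) ∣ a * b) :
    ‖∑ t ∈ Finset.range T, unitExp (α * (c * d ^ 2 * t ^ 2 + b * d * t))‖ * (4 / d)
      ≤ (8 * Real.pi * c₀ * B + 2) * m := by
  set S := ∑ t ∈ Finset.range T, unitExp (α * (c * d ^ 2 * t ^ 2 + b * d * t)) with hS
  set u := unitExp ((a * b : ℤ) / (d : ℝ)) with hu
  have hd' : (0 : ℝ) < d := by exact_mod_cast hd
  have hm' : (0 : ℝ) < m := by exact_mod_cast hm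
  have hT' : (0 : ℝ) < T := by exact_mod_cast hm.trans_le hmT
  have hmT' : (m : ℝ) ≤ T := by exact_mod_cast hmT
  have hcR : |(c : ℝ)| ≤ c₀ := by exact_mod_cast hc₀
  have hbR : |(b : ℝ)| ≤ c₀ * d * T := by exact_mod_cast hb
  have hu1 : 4 / (d : ℝ) ≤ ‖u - 1‖ := by
    have h1 : ∀ n : ℤ, 1 / (d : ℝ) ≤ |(a * b : ℤ) / (d : ℝ) - n| := by
      intro n
      have h2 : (a * b : ℤ) / (d : ℝ) - n = ((a * b - n * d : ℤ) : ℝ) / d := by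
        push_cast; field_simp
      have h3 : (a * b - n * d : ℤ) ≠ 0 := by
        intro h0
        exact hdvd ⟨n, by linarith⟩
      have h4 : (1 : ℝ) ≤ |((a * b - n * d : ℤ) : ℝ)| := by
        exact_mod_cast Int.one_le_abs h3
      rw [h2, abs_div, abs_of_pos hd']
      gcongr
    have := le_norm_unitExp_sub_one h1
    calc 4 / (d : ℝ) = 4 * (1 / d) := by ring
      _ ≤ _ := this
  set f : ℕ → ℂ := fun t => unitExp (α * (c * d ^ 2 * t ^ 2 + b * d * t)) with hf
  have hdiff : ∀ t ∈ Finset.range T, ‖f t * u - f (t + m)‖ ≤ 8 * Real.pi * c₀ * B * m / T := by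
    intro t ht
    have htT : (t : ℝ) ≤ T := by exact_mod_cast (Finset.mem_range.mp ht).le
    set β := α - a / (m * d ^ 2) with hβ
    have hαβ : α = a / (m * d ^ 2) + β := by rw [hβ]; ring
    have h1 : f (t + m) = unitExp (α * (c * d ^ 2 * t ^ 2 + b * d * t) + (a * b : ℤ) / (d : ℝ)
        + β * (d * m * (b + 2 * c * d * t + c * d * m))) := by
      have : α * (c * d ^ 2 * (t + m : ℕ) ^ 2 + b * d * (t + m : ℕ))
          = α * (c * d ^ 2 * t ^ 2 + b * d * t) + (a * b : ℤ) / (d : ℝ)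
        + β * (d * m * (b + 2 * c * d * t + c * d * m))
          + ((2 * c * a * t + c * a * m : ℤ) : ℝ) := by
        rw [hαβ]
        push_cast
        field_simp
        ring
      simp only [hf]
      rw [this, unitExp_add, unitExp_intCast, mul_one]
    have h2 : f t * u = unitExp (α * (c * d ^ 2 * t ^ 2 + b * d * t) + (a * b : ℤ) / (d : ℝ)) := by
      rw [unitExp_add]
    rw [h1, h2]
    refine (norm_unitExp_sub_le _ _).trans ?_
    rw [sub_add_cancel_left, abs_neg, abs_mul, abs_mul, abs_of_pos (mul_pos hd' hm')]
    have h3 : |(b : ℝ) + 2 * c * d * t + c * d * m| ≤ 4 * c₀ * d * T := by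
      have h4 : |2 * (c : ℝ) * d * t| ≤ 2 * c₀ * d * T := by
        rw [abs_mul, abs_mul, abs_mul, abs_two, Nat.abs_cast, Nat.abs_cast]
        gcongr
      have h5 : |(c : ℝ) * d * m| ≤ c₀ * d * T := by
        rw [abs_mul, abs_mul, Nat.abs_cast, Nat.abs_cast]
        gcongr
      have h6 := abs_add_three (b : ℝ) (2 * c * d * t) (c * d * m)
      linarith
    calc 2 * Real.pi * (|β| * (d * m * |(b : ℝ) + 2 * c * d * t + c * d * m|))
        ≤ 2 * Real.pi * (B / (T ^ 2 * d ^ 2) * (d * m * (4 * c₀ * d * T))) := by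
          gcongr
      _ = 8 * Real.pi * c₀ * B * m / T := by field_simp; ring
  have hsum : S * (u - 1) = ∑ t ∈ Finset.range T, (f t * u - f (t + m))
      + (∑ t ∈ Finset.range T, f (t + m) - ∑ t ∈ Finset.range T, f t) := by
    rw [Finset.sum_sub_distrib, ← Finset.sum_mul, hS]
    ring
  have h1 : ‖∑ t ∈ Finset.range T, (f t * u - f (t + m))‖ ≤ 8 * Real.pi * c₀ * B * m := by
    refine (norm_sum_le _ _).trans ((Finset.sum_le_sum hdiff).trans (le_of_eq ?_))
    simp only [Finset.sum_const, Finset.card_range, nsmul_eq_mul]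
    field_simp
  have h2 := norm_sum_shift_sub_le f (by simp [hf]) T m
  calc ‖S‖ * (4 / d) ≤ ‖S‖ * ‖u - 1‖ := by gcongr
    _ = ‖S * (u - 1)‖ := (norm_mul _ _).symm
    _ ≤ 8 * Real.pi * c₀ * B * m + 2 * m := by
      rw [hsum]
      exact (norm_add_le _ _).trans (add_le_add h1 h2)
    _ = _ := by ring

set_option maxHeartbeats 800000 in
/-- If the product of two quadratic exponential sums along progressions of step `d` is large, then
the frequency is close to a rational that becomes trivial once the step is multiplied by `m`, and
the product decays like `1 / m`. -/
lemma exists_rational_of_large_product {c₁ b₁ c₂ b₂ : ℤ} {c₀ d T : ℕ} {α ε : ℝ}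
    (hc₁ : c₁ ≠ 0) (hc₂ : c₂ ≠ 0) (hc₁₀ : |c₁| ≤ c₀) (hc₂₀ : |c₂| ≤ c₀) (hd : 0 < d)
    (hb₁ : |b₁| ≤ c₀ * d * T) (hb₂ : |b₂| ≤ c₀ * d * T) (hε : 0 < ε) (hε1 : ε ≤ 1)
    (hT : 250000 * (c₀ : ℝ) ^ 3 * d ≤ ε ^ 9 * T)
    (hS : ε * (T : ℝ) ^ 2 ≤
      ‖∑ t ∈ Finset.range T, unitExp (α * (c₁ * d ^ 2 * t ^ 2 + b₁ * d * t))‖ *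
      ‖∑ t ∈ Finset.range T, unitExp (α * (c₂ * d ^ 2 * t ^ 2 + b₂ * d * t))‖) :
    ∃ (a : ℤ) (m : ℕ), 0 < m ∧
      ‖∑ t ∈ Finset.range T, unitExp (α * (c₁ * d ^ 2 * t ^ 2 + b₁ * d * t))‖ *
      ‖∑ t ∈ Finset.range T, unitExp (α * (c₂ * d ^ 2 * t ^ 2 + b₂ * d * t))‖
        ≤ 16 * c₀ * (T : ℝ) ^ 2 / m ∧
      |α - a / (m * d ^ 2)| ≤ 1760 * c₀ / (ε ^ 6 * T ^ 2 * d ^ 2) ∧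
      (d : ℤ) ∣ a * b₁ ∧ (d : ℤ) ∣ a * b₂ := by
  have hd' : (1 : ℝ) ≤ d := by exact_mod_cast hd
  have hd0 : (0 : ℝ) < d := by linarith
  have hc₀1 : (1 : ℝ) ≤ c₀ := by exact_mod_cast (Int.one_le_abs hc₁).trans hc₁₀
  have hc₀n : 0 < c₀ := by
    have : (0 : ℝ) < c₀ := by linarith
    exact_mod_cast this
  have hT0 : (0 : ℝ) < T := by
    by_contra h0
    have : (T : ℝ) = 0 := le_antisymm (not_lt.mp h0) (Nat.cast_nonneg T)
    rw [this] at hT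
    have : 0 < 250000 * (c₀ : ℝ) ^ 3 * d := by positivity
    linarith
  have hε9 : ε ^ 9 ≤ ε ^ 4 := pow_le_pow_of_le_one hε.le hε1 (by norm_num)
  have hc₀3 : (c₀ : ℝ) ≤ c₀ ^ 3 := le_self_pow₀ hc₀1 (by norm_num)
  have hTε4 : 250000 * (c₀ : ℝ) ≤ ε ^ 4 * T := by
    calc 250000 * (c₀ : ℝ) = 250000 * c₀ * 1 := by ring
      _ ≤ 250000 * (c₀ : ℝ) ^ 3 * d := by gcongr
      _ ≤ ε ^ 9 * T := hT
      _ ≤ ε ^ 4 * T := by gcongr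
  have hε4 : ε ^ 4 ≤ ε ^ 2 := pow_le_pow_of_le_one hε.le hε1 (by norm_num)
  have hTε2 : 250000 * (c₀ : ℝ) ≤ ε ^ 2 * T := hTε4.trans (by gcongr)
  set H := ⌊ε ^ 2 * T / (40 * c₀)⌋₊ with hH
  have hH1 : (H : ℝ) ≤ ε ^ 2 * T / (40 * c₀) := Nat.floor_le (by positivity)
  have hH2 : ε ^ 2 * T / (40 * c₀) ≤ (H : ℝ) + 1 := (Nat.lt_floor_add_one _).le
  rw [le_div_iff₀ (by positivity)] at hH1
  rw [div_le_iff₀ (by positivity)] at hH2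
  have hHT : 40 * c₀ * H ≤ ε ^ 2 * T := by linarith
  have hTH : ε ^ 2 * T ≤ 80 * c₀ * H := by nlinarith
  have hHε : 16 ≤ ε ^ 2 * H := by
    have h1 : ε ^ 2 * (ε ^ 2 * T) ≤ ε ^ 2 * (80 * c₀ * H) := by gcongr
    have h2 : (c₀ : ℝ) * 16 ≤ c₀ * (ε ^ 2 * H) := by nlinarith
    exact le_of_mul_le_mul_left h2 (by linarith)
  have hHpos : 0 < H := by
    rcases Nat.eq_zero_or_pos H with h0 | h0
    · rw [h0] at hHε; norm_num at hHε
    · exact h0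
  have hHR : (0 : ℝ) < H := by exact_mod_cast hHpos
  obtain ⟨q, hq1, hq2⟩ := Real.exists_rat_abs_sub_le_and_den_le (α * d ^ 2)
    (n := 4 * c₀ * H) (by positivity)
  set m := q.den with hm
  set a := q.num with ha
  have hmpos : 0 < m := q.den_pos
  have hmR : (0 : ℝ) < m := by exact_mod_cast hmpos
  have ham : IsCoprime a m := by
    rw [Int.isCoprime_iff_gcd_eq_one]
    exact q.reduced
  have hqam : (q : ℝ) = a / m := by
    rw [hm, ha]; exact Rat.cast_def q
  have hθ : |α * d ^ 2 - a / m| ≤ 1 / (4 * c₀ * H * m) := by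
    rw [← hqam]
    refine hq1.trans ?_
    push_cast
    gcongr
    linarith
  have hrw : ∀ (c b : ℤ), (∑ t ∈ Finset.range T, unitExp (α * (c * d ^ 2 * t ^ 2 + b * d * t)))
      = ∑ t ∈ Finset.range T, unitExp ((c * (α * d ^ 2)) * t ^ 2 + (α * b * d) * t) := by
    intro c b
    refine Finset.sum_congr rfl fun t _ => ?_
    congr 1
    ring
  set S₁ := ‖∑ t ∈ Finset.range T, unitExp (α * (c₁ * d ^ 2 * t ^ 2 + b₁ * d * t))‖ with hS₁
  set S₂ := ‖∑ t ∈ Finset.range T, unitExp (α * (c₂ * d ^ 2 * t ^ 2 + b₂ * d * t))‖ with hS₂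
  have hS₁T : S₁ ≤ T := by
    simpa using norm_sum_unitExp_le_card (Finset.range T)
      fun t : ℕ => α * (c₁ * d ^ 2 * t ^ 2 + b₁ * d * t)
  have hS₂T : S₂ ≤ T := by
    simpa using norm_sum_unitExp_le_card (Finset.range T)
      fun t : ℕ => α * (c₂ * d ^ 2 * t ^ 2 + b₂ * d * t)
  have hS₁0 : 0 ≤ S₁ := norm_nonneg _
  have hS₂0 : 0 ≤ S₂ := norm_nonneg _
  have hS₁ε : ε * T ≤ S₁ := by
    refine le_of_mul_le_mul_right ?_ hT0
    calc ε * T * T = ε * (T : ℝ) ^ 2 := by ring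
      _ ≤ S₁ * S₂ := hS
      _ ≤ S₁ * T := by gcongr
  have hS₂ε : ε * T ≤ S₂ := by
    refine le_of_mul_le_mul_right ?_ hT0
    calc ε * T * T = ε * (T : ℝ) ^ 2 := by ring
      _ ≤ S₁ * S₂ := hS
      _ ≤ T * S₂ := by gcongr
      _ = S₂ * T := by ring
  have hsq₁ : S₁ ^ 2 ≤ 16 * c₀ * T ^ 2 / m := by
    have h := hS₁ε
    rw [hS₁, hrw] at h ⊢
    exact sq_norm_quadratic_sum_le hc₁ hc₁₀ hHpos hmpos ham hθ hε hε1 hHT hq2 h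
  have hsq₂ : S₂ ^ 2 ≤ 16 * c₀ * T ^ 2 / m := by
    have h := hS₂ε
    rw [hS₂, hrw] at h ⊢
    exact sq_norm_quadratic_sum_le hc₂ hc₂₀ hHpos hmpos ham hθ hε hε1 hHT hq2 h
  have hβ : |α * d ^ 2 - a / m| ≤ 1760 * c₀ / (ε ^ 6 * T ^ 2) := by
    have h := hS₁ε
    rw [hS₁, hrw] at h
    exact abs_sub_le_of_quadratic_sum hc₁ hc₁₀ hmpos ham hθ hε hε1 hHT hTH hHε hq2 h
  have hβ' : |α - a / (m * d ^ 2)| ≤ 1760 * c₀ / (ε ^ 6 * T ^ 2 * d ^ 2) := by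
    have h1 : α - a / (m * d ^ 2) = (α * d ^ 2 - a / m) / d ^ 2 := by field_simp
    rw [h1, abs_div, abs_of_pos (show (0 : ℝ) < d ^ 2 by positivity)]
    calc |α * d ^ 2 - a / m| / (d : ℝ) ^ 2
        ≤ 1760 * c₀ / (ε ^ 6 * T ^ 2) / d ^ 2 := by gcongr
      _ = _ := by field_simp
  have hmε : ε ^ 2 * m ≤ 16 * c₀ := by
    have h1 : (ε * T) ^ 2 ≤ 16 * c₀ * T ^ 2 / m := (pow_le_pow_left₀ (by positivity) hS₁ε 2).trans hsq₁
    rw [le_div_iff₀ hmR] at h1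
    have h2 : (T : ℝ) ^ 2 * (ε ^ 2 * m) ≤ T ^ 2 * (16 * c₀) := by linarith [mul_pow ε (T : ℝ) 2]
    exact le_of_mul_le_mul_left h2 (by positivity)
  have hmT : m ≤ T := by
    have h1 : ε ^ 2 * m ≤ ε ^ 2 * T := by linarith
    exact_mod_cast le_of_mul_le_mul_left h1 (by positivity)
  have hdvd : ∀ (c b : ℤ), |c| ≤ c₀ → |b| ≤ c₀ * d * T →
      ε * T ≤ ‖∑ t ∈ Finset.range T, unitExp (α * (c * d ^ 2 * t ^ 2 + b * d * t))‖ →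
      (d : ℤ) ∣ a * b := by
    intro c b hc hb hSε
    by_contra hnd
    have h1 := norm_sum_mul_le_of_not_dvd (B := 1760 * c₀ / ε ^ 6) hc hd hmpos hmT hb
      (by positivity) (hβ'.trans (le_of_eq (by field_simp))) hnd
    have h2 : ε * T * (4 / d) ≤ (8 * Real.pi * c₀ * (1760 * c₀ / ε ^ 6) + 2) * m :=
      le_trans (by gcongr) h1
    have h3 : 8 * Real.pi * c₀ * (1760 * c₀ / ε ^ 6) + 2 ≤ 46000 * c₀ ^ 2 / ε ^ 6 := by
      rw [le_div_iff₀ (by positivity)]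
      have h4 : (8 * Real.pi * c₀ * (1760 * c₀ / ε ^ 6) + 2) * ε ^ 6
          = 14080 * Real.pi * c₀ ^ 2 + 2 * ε ^ 6 := by field_simp; ring
      have h5 : ε ^ 6 ≤ 1 := pow_le_one₀ hε.le hε1
      have h6 : (1 : ℝ) ≤ c₀ ^ 2 := one_le_pow₀ hc₀1
      rw [h4]
      nlinarith [Real.pi_lt_d2]
    have h4 : ε * T * (4 / d) ≤ 46000 * c₀ ^ 2 / ε ^ 6 * m := h2.trans (by gcongr)
    have h5 : ε ^ 9 * T * 4 ≤ 46000 * c₀ ^ 2 * (ε ^ 2 * m) * d := by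
      have h6 := mul_le_mul_of_nonneg_right h4 (show 0 ≤ ε ^ 8 * d by positivity)
      have h7 : ε * T * (4 / d) * (ε ^ 8 * d) = ε ^ 9 * T * 4 := by field_simp
      have h8 : 46000 * c₀ ^ 2 / ε ^ 6 * m * (ε ^ 8 * d) = 46000 * c₀ ^ 2 * (ε ^ 2 * m) * d := by
        field_simp
      rwa [h7, h8] at h6
    have h6 : 46000 * c₀ ^ 2 * (ε ^ 2 * m) * d ≤ 46000 * c₀ ^ 2 * (16 * c₀) * (d : ℝ) := by
      gcongr
    have h7 : 0 < (c₀ : ℝ) ^ 3 * d := by positivity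
    have h8 : 46000 * c₀ ^ 2 * (16 * c₀) * (d : ℝ) = 736000 * (c₀ ^ 3 * d) := by ring
    linarith
  refine ⟨a, m, hmpos, ?_, hβ', hdvd c₁ b₁ hc₁₀ hb₁ hS₁ε, hdvd c₂ b₂ hc₂₀ hb₂ hS₂ε⟩
  nlinarith [sq_nonneg (S₁ - S₂)]

/-- The proportion of the `ℓ²` Fourier mass of `A ⊆ {1, …, N}`, viewed in `ℤ/2N`, carried by the
frequency `j / 2N`. -/
noncomputable def fourierMass (A : Finset ℕ) (N j : ℕ) : ℝ :=
  ‖∑ a ∈ A, unitExp ((j : ℝ) / (2 * N : ℕ) * a)‖ ^ 2 / ((2 * N : ℕ) * A.card)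

lemma fourierMass_nonneg (A : Finset ℕ) (N j : ℕ) : 0 ≤ fourierMass A N j := by
  unfold fourierMass
  positivity

lemma fourierMass_zero {A : Finset ℕ} (hA : A.Nonempty) (N : ℕ) :
    fourierMass A N 0 = A.card / (2 * N : ℕ) := by
  have : (A.card : ℝ) ≠ 0 := by exact_mod_cast hA.card_pos.ne'
  simp only [fourierMass, Nat.cast_zero, zero_div, zero_mul, unitExp_zero, Finset.sum_const,
    nsmul_eq_mul, mul_one, Complex.norm_natCast]
  field_simp

lemma sum_fourierMass_mul_unitExp {A : Finset ℕ} {N : ℕ} (hN : 0 < N) (hA : A ⊆ Finset.Icc 1 N)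
    (hne : A.Nonempty) {w : ℤ} (hwN : |w| ≤ N)
    (hw : ∀ a ∈ A, ∀ a' ∈ A, a ≠ a' → (a : ℤ) - a' ≠ w) :
    ∑ j ∈ Finset.range (2 * N), (fourierMass A N j : ℂ) * unitExp ((j : ℝ) / (2 * N : ℕ) * w)
      = if w = 0 then 1 else 0 := by
  have hL : 0 < 2 * N := by omega
  have hLc : ((2 * N : ℕ) : ℂ) ≠ 0 := by exact_mod_cast hL.ne'
  have hAc : (A.card : ℂ) ≠ 0 := by exact_mod_cast hne.card_pos.ne'
  have hterm : ∀ j : ℕ, (fourierMass A N j : ℂ) * unitExp ((j : ℝ) / (2 * N : ℕ) * w)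
      = (∑ a ∈ A, ∑ b ∈ A, unitExp ((j : ℝ) / (2 * N : ℕ) * ((a - b + w : ℤ) : ℝ)))
        / ((2 * N : ℕ) * A.card) := by
    intro j
    rw [fourierMass, Complex.ofReal_div, sq_norm_sum_unitExp, div_mul_eq_mul_div, Finset.sum_mul]
    congr 1
    · refine Finset.sum_congr rfl fun a _ => ?_
      rw [Finset.sum_mul]
      refine Finset.sum_congr rfl fun b _ => ?_
      rw [← unitExp_add]
      congr 1
      push_cast
      ring
    · push_cast
      ring
  rw [Finset.sum_congr rfl fun j _ => hterm j, ← Finset.sum_div, Finset.sum_comm]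
  have hinner : ∀ a ∈ A, ∑ j ∈ Finset.range (2 * N), ∑ b ∈ A,
      unitExp ((j : ℝ) / (2 * N : ℕ) * ((a - b + w : ℤ) : ℝ))
        = if w = 0 then ((2 * N : ℕ) : ℂ) else 0 := by
    intro a ha
    rw [Finset.sum_comm]
    rw [Finset.sum_congr rfl fun (b : ℕ) _ => sum_unitExp_div hL ((a : ℤ) - b + w)]
    have key : ∀ b ∈ A, (((2 * N : ℕ) : ℤ) ∣ (a : ℤ) - b + w) ↔ (w = 0 ∧ a = b) := by
      intro b hb
      have h1 := Finset.mem_Icc.mp (hA ha)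
      have h2 := Finset.mem_Icc.mp (hA hb)
      have h3 := abs_le.mp hwN
      constructor
      · intro hdvd
        have h0 : (a : ℤ) - b + w = 0 := by
          refine Int.eq_zero_of_abs_lt_dvd hdvd ?_
          rw [abs_lt]
          push_cast
          omega
        by_cases hab : a = b
        · exact ⟨by subst hab; linarith, hab⟩
        · exact absurd (by linarith) (hw b hb a ha (Ne.symm hab))
      · rintro ⟨rfl, rfl⟩
        simp
    by_cases hw0 : w = 0
    · rw [if_pos hw0]
      rw [Finset.sum_congr rfl fun b hb => if_congr (by rw [key b hb, and_iff_right hw0]) rfl rfl]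
      rw [Finset.sum_ite_eq, if_pos ha]
    · rw [if_neg hw0]
      refine Finset.sum_eq_zero fun b hb => if_neg ?_
      rw [key b hb]
      exact fun h => hw0 h.1
  rw [Finset.sum_congr rfl hinner, Finset.sum_const, nsmul_eq_mul]
  split_ifs
  · field_simp
  · simp

lemma sum_fourierMass {A : Finset ℕ} {N : ℕ} (hN : 0 < N) (hA : A ⊆ Finset.Icc 1 N)
    (hne : A.Nonempty) : ∑ j ∈ Finset.range (2 * N), fourierMass A N j = 1 := by
  have h := sum_fourierMass_mul_unitExp (w := 0) hN hA hne (by simp)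
    (fun a _ a' _ haa' h0 => haa' (by omega))
  simp only [Int.cast_zero, mul_zero, unitExp_zero, mul_one, if_true] at h
  exact_mod_cast h

/-- A weighted test function that is large on `Z` and has small mean must be negative somewhere
else; if it decays like `K / m` at points of `Z' m`, then some `Z' u` has larger mass than `Z`. -/
lemma exists_mass_increment {ι : Type*} (J : Finset ι) {ν : ι → ℝ} {F : ι → ℂ} {Z : ι → Prop}
    {Z' : ℕ → ι → Prop} {K δ : ℝ} [DecidablePred Z] [∀ u, DecidablePred (Z' u)]
    (hν : ∀ j, 0 ≤ ν j) (hsum : ∑ j ∈ J, ν j = 1) (hK : 1 ≤ K) (hδ : 0 < δ) (hδ1 : δ ≤ 1)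
    (hmean : ∑ j ∈ J, ν j * (F j).re ≤ δ / 8)
    (hZ : ∀ j ∈ J, Z j → 1 / 2 ≤ (F j).re)
    (hmono : ∀ j ∈ J, Z j → ∀ u, 0 < u → Z' u j)
    (hbad : ∀ j ∈ J, ¬ Z j → δ / 8 ≤ ‖F j‖ →
      ∃ m : ℕ, 0 < m ∧ ‖F j‖ ≤ K / m ∧ ∀ u, 0 < u → m ∣ u → Z' u j)
    (hmass : δ ≤ ∑ j ∈ J with Z j, ν j) :
    ∃ u : ℕ, 0 < u ∧ (u : ℝ) ≤ 8 * K / δ ∧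
      (1 + 1 / (8 * K)) * ∑ j ∈ J with Z j, ν j ≤ ∑ j ∈ J with Z' u j, ν j := by
  classical
  set M := ∑ j ∈ J with Z j, ν j with hM
  set Q := ⌊8 * K / δ⌋₊ with hQ
  have hQ1 : (Q : ℝ) ≤ 8 * K / δ := Nat.floor_le (by positivity)
  have hQpos : 0 < Q := by
    rw [hQ, Nat.floor_pos, le_div_iff₀ hδ]
    linarith
  have hchoice : ∀ j : ι, ∃ ω : ℝ, 0 ≤ ω ∧ (j ∈ J →
      ((if Z j then (1 / 2 : ℝ) else 0) - δ / 8 - K * ω ≤ (F j).re ∧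
      Q * ((if Z j then (1 : ℝ) else 0) + ω / 2) ≤ ((Finset.Ioc 0 Q).filter (Z' · j)).card)) := by
    intro j
    by_cases hj : j ∈ J
    swap
    · exact ⟨0, le_rfl, fun h => absurd h hj⟩
    by_cases hZj : Z j
    · refine ⟨0, le_rfl, fun _ => ⟨?_, ?_⟩⟩
      · rw [if_pos hZj]
        linarith [hZ j hj hZj]
      · rw [Finset.filter_true_of_mem fun u hu => hmono j hj hZj u (Finset.mem_Ioc.mp hu).1]
        simp [hZj]
    by_cases hF : δ / 8 ≤ ‖F j‖
    · obtain ⟨m, hm, hFm, hu⟩ := hbad j hj hZj hF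
      have hmR : (0 : ℝ) < m := by exact_mod_cast hm
      refine ⟨1 / m, by positivity, fun _ => ⟨?_, ?_⟩⟩
      · rw [if_neg hZj]
        have h1 := (abs_le.mp (Complex.abs_re_le_norm (F j))).1
        have h2 : K * (1 / (m : ℝ)) = K / m := by ring
        linarith
      · have hmQ : m ≤ Q := by
          rw [hQ, Nat.le_floor_iff (by positivity), le_div_iff₀ hδ]
          have := hF.trans hFm
          rw [le_div_iff₀ hmR] at this
          linarith
        have h1 : Q / m ≤ ((Finset.Ioc 0 Q).filter (Z' · j)).card := by
          rw [← Nat.Ioc_filter_dvd_card_eq_div]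
          refine Finset.card_le_card fun u hu' => ?_
          rw [Finset.mem_filter] at hu' ⊢
          exact ⟨hu'.1, hu u (Finset.mem_Ioc.mp hu'.1).1 hu'.2⟩
        have h2 : Q ≤ 2 * m * (Q / m) := by
          have h3 := Nat.div_add_mod Q m
          have h4 := Nat.mod_lt Q hm
          have h5 : 1 ≤ Q / m := (Nat.one_le_div_iff hm).mpr hmQ
          have h6 : m * 1 ≤ m * (Q / m) := Nat.mul_le_mul_left m h5
          nlinarith
        have h3 : (Q : ℝ) ≤ 2 * m * ((Q / m : ℕ) : ℝ) := by exact_mod_cast h2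
        have h4 : ((Q / m : ℕ) : ℝ) ≤ ((Finset.Ioc 0 Q).filter (Z' · j)).card := by
          exact_mod_cast h1
        rw [if_neg hZj]
        refine le_trans ?_ h4
        rw [zero_add, div_div, mul_one_div, div_le_iff₀ (by positivity)]
        linarith
    · refine ⟨0, le_rfl, fun _ => ⟨?_, ?_⟩⟩
      · rw [if_neg hZj]
        have h1 := (abs_le.mp (Complex.abs_re_le_norm (F j))).1
        linarith [not_le.mp hF]
      · simp [hZj]
  choose ω hω0 hω using hchoice
  set W := ∑ j ∈ J, ν j * ω j with hW
  have hMsum : M = ∑ j ∈ J, ν j * (if Z j then 1 else 0) := by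
    rw [hM, Finset.sum_filter]
    exact Finset.sum_congr rfl fun j _ => by split_ifs <;> simp
  have hlow : M / 2 - δ / 8 - K * W ≤ δ / 8 := by
    refine le_trans (le_of_eq ?_) ((Finset.sum_le_sum fun j hj =>
      mul_le_mul_of_nonneg_left (hω j hj).1 (hν j)).trans hmean)
    rw [hMsum, hW, Finset.mul_sum, Finset.sum_div]
    have h8 : δ / 8 = ∑ j ∈ J, ν j * (δ / 8) := by rw [← Finset.sum_mul, hsum, one_mul]
    rw [h8, ← Finset.sum_sub_distrib, ← Finset.sum_sub_distrib, ← h8]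
    exact Finset.sum_congr rfl fun j _ => by split_ifs <;> ring
  have hWM : M / 4 ≤ K * W := by linarith
  have hdouble : (Q : ℝ) * (M + W / 2) ≤ ∑ u ∈ Finset.Ioc 0 Q, ∑ j ∈ J with Z' u j, ν j := by
    have h1 : ∑ u ∈ Finset.Ioc 0 Q, ∑ j ∈ J with Z' u j, ν j
        = ∑ j ∈ J, ν j * ((Finset.Ioc 0 Q).filter (Z' · j)).card := by
      simp_rw [Finset.sum_filter]
      rw [Finset.sum_comm]
      refine Finset.sum_congr rfl fun j _ => ?_
      rw [← Finset.sum_filter, Finset.sum_const, nsmul_eq_mul, mul_comm]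
    rw [h1]
    refine le_trans (le_of_eq ?_) (Finset.sum_le_sum fun j hj =>
      mul_le_mul_of_nonneg_left (hω j hj).2 (hν j))
    rw [hMsum, hW, Finset.sum_div, ← Finset.sum_add_distrib, Finset.mul_sum]
    exact Finset.sum_congr rfl fun j _ => by ring
  have hfin : (1 + 1 / (8 * K)) * M ≤ M + W / 2 := by
    have h1 : (1 / (8 * K)) * M = M / 4 / K / 2 := by field_simp; ring
    have h2 : M / 4 / K ≤ W := by
      rw [div_le_iff₀ (by linarith)]
      linarith
    linarith
  obtain ⟨u, hu, hle⟩ := Finset.exists_le_of_sum_le (s := Finset.Ioc 0 Q)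
    (f := fun _ => M + W / 2) (g := fun u => ∑ j ∈ J with Z' u j, ν j)
    ⟨Q, Finset.mem_Ioc.mpr ⟨hQpos, le_rfl⟩⟩ (by
      rw [Finset.sum_const, Nat.card_Ioc, nsmul_eq_mul]
      simpa using hdouble)
  rw [Finset.mem_Ioc] at hu
  exact ⟨u, hu.1, le_trans (by exact_mod_cast hu.2) hQ1, hfin.trans hle⟩

/-- The integer quadratic `c x² + b x + e`. -/
def quadVal (c b e x : ℤ) : ℤ := c * x ^ 2 + b * x + e

lemma card_filter_quadVal_eq_le {c b e : ℤ} (hc : c ≠ 0) {d : ℕ} (hd : 0 < d) (r y : ℤ) (T : ℕ) :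
    ((Finset.range T).filter fun s : ℕ => quadVal c b e (r + d * s) = y).card ≤ 2 := by
  by_contra! h
  obtain ⟨s₁, s₂, s₃, h₁, h₂, h₃, h₁₂, h₁₃, h₂₃⟩ := Finset.two_lt_card_iff.mp h
  have hdz : (d : ℤ) ≠ 0 := by exact_mod_cast hd.ne'
  have key : ∀ s s' : ℕ, quadVal c b e (r + d * s) = y → quadVal c b e (r + d * s') = y → s ≠ s' →
      c * (2 * r + d * s + d * s') + b = 0 := by
    intro s s' hs hs' hss
    have h0 : ((d : ℤ) * (s - s')) * (c * (2 * r + d * s + d * s') + b) = 0 := by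
      have := hs.trans hs'.symm
      unfold quadVal at this
      linear_combination this
    refine (mul_eq_zero.mp h0).resolve_left (mul_ne_zero hdz ?_)
    rw [sub_ne_zero]
    exact_mod_cast hss
  have e1 := key s₁ s₂ (Finset.mem_filter.mp h₁).2 (Finset.mem_filter.mp h₂).2 h₁₂
  have e2 := key s₁ s₃ (Finset.mem_filter.mp h₁).2 (Finset.mem_filter.mp h₃).2 h₁₃
  have h0 : c * d * ((s₂ : ℤ) - s₃) = 0 := by linear_combination e1 - e2
  refine mul_ne_zero (mul_ne_zero hc hdz) ?_ h0
  rw [sub_ne_zero]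
  exact_mod_cast h₂₃

lemma abs_quadVal_le {c b e x : ℤ} {c₀ : ℕ} (hc : |c| ≤ c₀) (hb : |b| ≤ c₀) (he : |e| ≤ c₀)
    {y : ℤ} (hx : 1 ≤ x) (hxy : x ≤ y) : |quadVal c b e x| ≤ 3 * c₀ * y ^ 2 := by
  unfold quadVal
  have h0 : (0 : ℤ) ≤ c₀ := Int.natCast_nonneg _
  have hx2 : x ≤ x ^ 2 := by nlinarith
  have hxy2 : x ^ 2 ≤ y ^ 2 := by nlinarith
  have h1 : |c * x ^ 2| ≤ c₀ * y ^ 2 := by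
    rw [abs_mul, abs_of_nonneg (sq_nonneg x)]
    gcongr
  have h2 : |b * x| ≤ c₀ * y ^ 2 := by
    rw [abs_mul, abs_of_pos (by linarith : 0 < x)]
    have := hx2.trans hxy2
    gcongr
  have h3 : |e| ≤ c₀ * y ^ 2 := by
    have : 1 ≤ y ^ 2 := by linarith
    nlinarith
  have := abs_add_three (c * x ^ 2) (b * x) e
  linarith

lemma quadVal_add_mul (c b e R d y : ℤ) :
    quadVal c b e (R + d * y) = quadVal c b e R + (c * d ^ 2 * y ^ 2 + (2 * c * R + b) * d * y) := by
  unfold quadVal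
  ring

/-- The normalised exponential sum attached to the values of two quadratics along progressions of
step `d` and length `T`. -/
noncomputable def progressionSum (P₁ P₂ : ℕ → ℤ) (T : ℕ) (α : ℝ) : ℂ :=
  ((T : ℂ) ^ 2)⁻¹ * ∑ s ∈ Finset.range T, ∑ t ∈ Finset.range T, unitExp (α * (P₁ s + P₂ t : ℤ))

lemma sum_fourierMass_mul_re_progressionSum_le {A : Finset ℕ} {N T k : ℕ} {P₁ P₂ : ℕ → ℤ}
    (hN : 0 < N) (hA : A ⊆ Finset.Icc 1 N) (hne : A.Nonempty) (hT : 0 < T)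
    (hP : ∀ s < T, ∀ t < T, |P₁ s + P₂ t| ≤ N)
    (hAP : ∀ a ∈ A, ∀ a' ∈ A, a ≠ a' → ∀ s t : ℕ, (a : ℤ) - a' ≠ P₁ s + P₂ t)
    (hcard : ∀ y : ℤ, ((Finset.range T).filter fun s => P₁ s = y).card ≤ k) :
    ∑ j ∈ Finset.range (2 * N),
      fourierMass A N j * (progressionSum P₁ P₂ T ((j : ℝ) / (2 * N : ℕ))).re ≤ k / T := by
  have h1 : ((∑ j ∈ Finset.range (2 * N),
      fourierMass A N j * (progressionSum P₁ P₂ T ((j : ℝ) / (2 * N : ℕ))).re : ℝ))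
      = (∑ j ∈ Finset.range (2 * N),
      (fourierMass A N j : ℂ) * progressionSum P₁ P₂ T ((j : ℝ) / (2 * N : ℕ))).re := by
    rw [Complex.re_sum]
    exact Finset.sum_congr rfl fun j _ => (Complex.re_ofReal_mul _ _).symm
  have h2 : ∑ j ∈ Finset.range (2 * N),
      (fourierMass A N j : ℂ) * progressionSum P₁ P₂ T ((j : ℝ) / (2 * N : ℕ))
      = ((T : ℂ) ^ 2)⁻¹ * ∑ s ∈ Finset.range T, ∑ t ∈ Finset.range T,
        ∑ j ∈ Finset.range (2 * N),
          (fourierMass A N j : ℂ) * unitExp ((j : ℝ) / (2 * N : ℕ) * (P₁ s + P₂ t : ℤ)) := by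
    simp only [progressionSum]
    rw [Finset.sum_congr rfl fun s _ => Finset.sum_comm, Finset.sum_comm, Finset.mul_sum]
    refine Finset.sum_congr rfl fun j _ => ?_
    rw [mul_left_comm, Finset.mul_sum]
    congr 1
    exact Finset.sum_congr rfl fun s _ => Finset.mul_sum _ _ _
  have h3 : ∑ s ∈ Finset.range T, ∑ t ∈ Finset.range T,
        ∑ j ∈ Finset.range (2 * N),
          (fourierMass A N j : ℂ) * unitExp ((j : ℝ) / (2 * N : ℕ) * (P₁ s + P₂ t : ℤ))
      = ((∑ t ∈ Finset.range T, ((Finset.range T).filter fun s => P₁ s = - P₂ t).card : ℕ) : ℂ) := by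
    rw [Finset.sum_comm, Nat.cast_sum]
    refine Finset.sum_congr rfl fun t ht => ?_
    rw [Finset.card_filter, Nat.cast_sum]
    refine Finset.sum_congr rfl fun s hs => ?_
    rw [sum_fourierMass_mul_unitExp hN hA hne
      (hP s (Finset.mem_range.mp hs) t (Finset.mem_range.mp ht))
      (fun a ha a' ha' haa' => hAP a ha a' ha' haa' s t)]
    simp only [Nat.cast_ite, Nat.cast_one, Nat.cast_zero]
    exact if_congr add_eq_zero_iff_eq_neg rfl rfl
  have h4 : (∑ t ∈ Finset.range T, ((Finset.range T).filter fun s => P₁ s = - P₂ t).card)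
      ≤ T * k := by
    refine (Finset.sum_le_sum fun t _ => hcard _).trans ?_
    simp
  have hTR : (0 : ℝ) < T := by exact_mod_cast hT
  have h5 : ∀ n : ℕ, (((T : ℂ) ^ 2)⁻¹ * (n : ℂ)).re = n / (T : ℝ) ^ 2 := by
    intro n
    have : ((T : ℂ) ^ 2)⁻¹ * (n : ℂ) = ((n / (T : ℝ) ^ 2 : ℝ) : ℂ) := by
      push_cast
      ring
    rw [this, Complex.ofReal_re]
  rw [h1, h2, h3, h5, div_le_div_iff₀ (by positivity) hTR]
  have h6 : ((∑ t ∈ Finset.range T,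
      ((Finset.range T).filter fun s => P₁ s = - P₂ t).card : ℕ) : ℝ) ≤ T * k := by
    exact_mod_cast h4
  nlinarith

lemma norm_progressionSum (c₁ b₁ e₁ c₂ b₂ e₂ r₁ r₂ : ℤ) (d T : ℕ) (α : ℝ) :
    ‖progressionSum (fun s => quadVal c₁ b₁ e₁ (r₁ + d * s))
      (fun t => quadVal c₂ b₂ e₂ (r₂ + d * t)) T α‖
    = ‖∑ t ∈ Finset.range T,
        unitExp (α * (c₁ * d ^ 2 * t ^ 2 + (2 * c₁ * r₁ + b₁ : ℤ) * d * t))‖ *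
      ‖∑ t ∈ Finset.range T,
        unitExp (α * (c₂ * d ^ 2 * t ^ 2 + (2 * c₂ * r₂ + b₂ : ℤ) * d * t))‖ / (T : ℝ) ^ 2 := by
  have hsplit : ∑ s ∈ Finset.range T, ∑ t ∈ Finset.range T,
      unitExp (α * (quadVal c₁ b₁ e₁ (r₁ + d * s) + quadVal c₂ b₂ e₂ (r₂ + d * t) : ℤ))
      = unitExp (α * (quadVal c₁ b₁ e₁ r₁ + quadVal c₂ b₂ e₂ r₂ : ℤ)) *
      ((∑ s ∈ Finset.range T,
        unitExp (α * (c₁ * d ^ 2 * s ^ 2 + (2 * c₁ * r₁ + b₁ : ℤ) * d * s))) *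
      (∑ t ∈ Finset.range T,
        unitExp (α * (c₂ * d ^ 2 * t ^ 2 + (2 * c₂ * r₂ + b₂ : ℤ) * d * t)))) := by
    rw [Finset.sum_mul_sum, Finset.mul_sum]
    refine Finset.sum_congr rfl fun s _ => ?_
    rw [Finset.mul_sum]
    refine Finset.sum_congr rfl fun t _ => ?_
    rw [← unitExp_add, ← unitExp_add, quadVal_add_mul, quadVal_add_mul]
    congr 1
    push_cast
    ring
  rw [progressionSum, hsplit, norm_mul, norm_mul, norm_mul, norm_unitExp, one_mul, norm_inv,
    norm_pow, Complex.norm_natCast]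
  ring

lemma half_le_re_progressionSum {P₁ P₂ : ℕ → ℤ} {T : ℕ} {α : ℝ} (hT : 0 < T)
    (h : ∀ s < T, ∀ t < T, ∃ n : ℤ, |α * (P₁ s + P₂ t : ℤ) - n| ≤ 3 / 50) :
    1 / 2 ≤ (progressionSum P₁ P₂ T α).re := by
  have hTR : (0 : ℝ) < T := by exact_mod_cast hT
  have hterm : ∀ s ∈ Finset.range T, ∀ t ∈ Finset.range T,
      1 / 2 ≤ (unitExp (α * (P₁ s + P₂ t : ℤ))).re := by
    intro s hs t ht
    obtain ⟨n, hn⟩ := h s (Finset.mem_range.mp hs) t (Finset.mem_range.mp ht)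
    have h1 := norm_unitExp_sub_le (α * (P₁ s + P₂ t : ℤ)) n
    rw [unitExp_intCast] at h1
    have h2 := (abs_le.mp (Complex.abs_re_le_norm (unitExp (α * (P₁ s + P₂ t : ℤ)) - 1))).1
    rw [Complex.sub_re, Complex.one_re] at h2
    have h3 : 2 * Real.pi * |α * (P₁ s + P₂ t : ℤ) - n| ≤ 2 * 3.15 * (3 / 50) := by
      have := Real.pi_lt_d2.le
      gcongr
    have h4 : (2 * 3.15 * (3 / 50) : ℝ) ≤ 1 / 2 := by norm_num
    linarith
  have h1 : (T : ℝ) ^ 2 * (1 / 2) ≤ (∑ s ∈ Finset.range T, ∑ t ∈ Finset.range T,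
      unitExp (α * (P₁ s + P₂ t : ℤ))).re := by
    rw [Complex.re_sum]
    calc (T : ℝ) ^ 2 * (1 / 2) = ∑ s ∈ Finset.range T, ∑ t ∈ Finset.range T, (1 / 2 : ℝ) := by
          simp; ring
      _ ≤ _ := Finset.sum_le_sum fun s hs => by
          rw [Complex.re_sum]
          exact Finset.sum_le_sum fun t ht => hterm s hs t ht
  have h2 : ((T : ℂ) ^ 2)⁻¹ = ((((T : ℝ) ^ 2)⁻¹ : ℝ) : ℂ) := by push_cast; rfl
  rw [progressionSum, h2, Complex.re_ofReal_mul, inv_mul_eq_div, le_div_iff₀ (by positivity)]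
  linarith

/-- The frequency `α` lies within `σ²` of a frequency which is trivial along progressions of step
`d` based at points where two quadratics vanish modulo `d²` and have derivatives `p₁` and `p₂`. -/
def NearTrivial (p₁ p₂ : ℤ) (d : ℕ) (σ α : ℝ) : Prop :=
  ∃ γ : ℝ, (∃ k : ℤ, γ * d ^ 2 = k) ∧ (∃ k : ℤ, γ * d * p₁ = k) ∧ (∃ k : ℤ, γ * d * p₂ = k) ∧
    |α - γ| ≤ σ ^ 2

lemma NearTrivial.mul {p₁ p₂ : ℤ} {d : ℕ} {σ σ' α : ℝ} (h : NearTrivial p₁ p₂ d σ α) (u : ℕ)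
    (hσ : 0 ≤ σ) (hσσ' : σ ≤ σ') : NearTrivial p₁ p₂ (d * u) σ' α := by
  obtain ⟨γ, ⟨k, hk⟩, ⟨k₁, hk₁⟩, ⟨k₂, hk₂⟩, hγ⟩ := h
  refine ⟨γ, ⟨k * u ^ 2, ?_⟩, ⟨k₁ * u, ?_⟩, ⟨k₂ * u, ?_⟩, hγ.trans (by gcongr)⟩
  · push_cast
    rw [← hk]
    ring
  · push_cast
    rw [← hk₁]
    ring
  · push_cast
    rw [← hk₂]
    ring

lemma exists_int_mul_quadVal {c b e R : ℤ} {d : ℕ} {γ : ℝ}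
    (hR : (d : ℤ) ^ 2 ∣ quadVal c b e R) (h₁ : ∃ k : ℤ, γ * d ^ 2 = k)
    (h₂ : ∃ k : ℤ, γ * d * (2 * c * R + b : ℤ) = k) {x : ℤ} (hx : (d : ℤ) ∣ x - R) :
    ∃ n : ℤ, γ * quadVal c b e x = n := by
  obtain ⟨k, hk⟩ := h₁
  obtain ⟨l, hl⟩ := h₂
  obtain ⟨v, hv⟩ := hR
  obtain ⟨y, hy⟩ := hx
  refine ⟨k * v + c * k * y ^ 2 + l * y, ?_⟩
  have : x = R + d * y := by linarith
  rw [this, quadVal_add_mul, hv]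
  push_cast at hk hl ⊢
  rw [← hk, ← hl]
  ring

lemma nearTrivial_of_dvd {p₁ p₂ a : ℤ} {d m : ℕ} {σ α : ℝ} (hd : 0 < d) (hm : 0 < m)
    (h₁ : (d : ℤ) ∣ a * p₁) (h₂ : (d : ℤ) ∣ a * p₂) (hα : |α - a / (m * d ^ 2)| ≤ σ ^ 2) :
    NearTrivial p₁ p₂ (d * m) σ α := by
  have hd' : (d : ℝ) ≠ 0 := by exact_mod_cast hd.ne'
  have hm' : (m : ℝ) ≠ 0 := by exact_mod_cast hm.ne'
  have key : ∀ p : ℤ, (d : ℤ) ∣ a * p →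
      ∃ k : ℤ, (a / (m * d ^ 2) : ℝ) * ((d * m : ℕ) : ℝ) * p = k := by
    rintro p ⟨k, hk⟩
    refine ⟨k, ?_⟩
    have hk' : (a : ℝ) * p = d * k := by exact_mod_cast hk
    push_cast
    field_simp
    linarith
  refine ⟨a / (m * d ^ 2), ⟨a * m, ?_⟩, key p₁ h₁, key p₂ h₂, hα⟩
  push_cast
  field_simp

lemma exists_length_of_scale {c₀ d : ℕ} {δ σ : ℝ} (hc₀ : 1 ≤ c₀) (hd : 0 < d) (hδ : 0 < δ)
    (hδ1 : δ ≤ 1) (hσ : 0 < σ) (hsmall : 2 * 10 ^ 15 * (c₀ : ℝ) ^ 4 * d ^ 2 * σ ≤ δ ^ 9) :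
    ∃ T : ℕ, 20 * c₀ * d * σ * T ≤ 1 ∧ 1 ≤ 40 * c₀ * d * σ * T ∧
      250000 * (c₀ : ℝ) ^ 3 * d ≤ (δ / 8) ^ 9 * T ∧ 16 ≤ δ * T ∧ 5 * d ≤ T := by
  have hc : (1 : ℝ) ≤ c₀ := by exact_mod_cast hc₀
  have hdR : (1 : ℝ) ≤ d := by exact_mod_cast hd
  have hδ9 : δ ^ 9 ≤ 1 := pow_le_one₀ hδ.le hδ1
  have hpos : 0 < 20 * c₀ * d * σ := by positivity
  have hle : 20 * c₀ * d * σ * 2 ≤ 1 := by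
    have h1 : (c₀ : ℝ) ≤ c₀ ^ 4 := le_self_pow₀ hc (by norm_num)
    have h2 : (d : ℝ) ≤ d ^ 2 := le_self_pow₀ hdR (by norm_num)
    calc 20 * c₀ * d * σ * 2 = 40 * c₀ * d * σ := by ring
      _ ≤ 2 * 10 ^ 15 * (c₀ : ℝ) ^ 4 * d ^ 2 * σ := by gcongr; norm_num
      _ ≤ 1 := hsmall.trans hδ9
  refine ⟨⌊1 / (20 * c₀ * d * σ)⌋₊, ?_⟩
  set T := ⌊1 / (20 * c₀ * d * σ)⌋₊ with hT
  have hT1 : (T : ℝ) ≤ 1 / (20 * c₀ * d * σ) := Nat.floor_le (by positivity)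
  have hT2 : 1 / (20 * c₀ * d * σ) < (T : ℝ) + 1 := Nat.lt_floor_add_one _
  rw [le_div_iff₀ hpos] at hT1
  rw [div_lt_iff₀ hpos] at hT2
  have hT3 : 1 ≤ 40 * c₀ * d * σ * T := by linarith
  have hT4 : 250000 * (c₀ : ℝ) ^ 3 * d ≤ (δ / 8) ^ 9 * T := by
    have h1 : 250000 * (c₀ : ℝ) ^ 3 * d * 1
        ≤ 250000 * (c₀ : ℝ) ^ 3 * d * (40 * c₀ * d * σ * T) := by gcongr
    have h2 : 2 * 10 ^ 15 * (c₀ : ℝ) ^ 4 * d ^ 2 * σ * T ≤ δ ^ 9 * T := by gcongr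
    have h3 : (δ / 8) ^ 9 * T = δ ^ 9 * T / 134217728 := by ring
    have h4 : 0 ≤ (c₀ : ℝ) ^ 4 * d ^ 2 * σ * T := by positivity
    rw [h3, le_div_iff₀ (by norm_num)]
    linarith
  have hcd : (d : ℝ) ≤ (c₀ : ℝ) ^ 3 * d := le_mul_of_one_le_left (by positivity) (one_le_pow₀ hc)
  have hε : (δ / 8) ^ 9 ≤ δ / 8 := pow_le_of_le_one (by positivity) (by linarith) (by norm_num)
  have hT5 : (δ / 8) ^ 9 * T ≤ δ / 8 * T := by gcongr
  refine ⟨by linarith, hT3, hT4, by linarith, ?_⟩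
  have hT6 : δ / 8 * T ≤ T := mul_le_of_le_one_left (Nat.cast_nonneg T) (by linarith)
  have : 5 * (d : ℝ) ≤ T := by linarith
  exact_mod_cast this

open Classical in
/-- The Fourier mass of `A` on the frequencies satisfying `NearTrivial`. -/
noncomputable def zoneMass (A : Finset ℕ) (N : ℕ) (p₁ p₂ : ℤ) (d : ℕ) (σ : ℝ) : ℝ :=
  ∑ j ∈ (Finset.range (2 * N)).filter fun j : ℕ => NearTrivial p₁ p₂ d σ ((j : ℝ) / (2 * N : ℕ)),
    fourierMass A N j

lemma exists_base_point {c b e R : ℤ} {c₀ d T : ℕ} (hc₀ : |c| ≤ c₀) (hb₀ : |b| ≤ c₀)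
    (he₀ : |e| ≤ c₀) (hd : 0 < d) (hdT : 5 * d ≤ T) :
    ∃ r : ℤ, 1 ≤ r ∧ (d : ℤ) ^ 2 ∣ r - R ∧ |2 * c * r + b| ≤ c₀ * d * T ∧
      ∀ s : ℕ, s < T → |quadVal c b e (r + d * s)| ≤ 12 * c₀ * (d * T) ^ 2 := by
  have hd1 : (1 : ℤ) ≤ d := by exact_mod_cast hd
  have hd2 : (1 : ℤ) ≤ (d : ℤ) ^ 2 := one_le_pow₀ hd1
  have hdT' : 5 * (d : ℤ) ≤ T := by exact_mod_cast hdT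
  have hdd : 5 * (d : ℤ) ^ 2 ≤ d * T := by nlinarith
  have hc0 : (0 : ℤ) ≤ c₀ := Int.natCast_nonneg _
  have h1 := Int.emod_nonneg R (by positivity : (d : ℤ) ^ 2 ≠ 0)
  have h2 := Int.emod_lt_of_pos R (by positivity : 0 < (d : ℤ) ^ 2)
  refine ⟨R % (d : ℤ) ^ 2 + (d : ℤ) ^ 2, by linarith, ?_, ?_, ?_⟩
  · refine ⟨1 - R / (d : ℤ) ^ 2, ?_⟩
    have := Int.emod_add_mul_ediv R ((d : ℤ) ^ 2)
    linear_combination this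
  · set r := R % (d : ℤ) ^ 2 + (d : ℤ) ^ 2 with hr
    have hr1 : 0 ≤ r := by linarith
    have hr2 : r ≤ 2 * (d : ℤ) ^ 2 := by linarith
    calc |2 * c * r + b| ≤ |2 * c * r| + |b| := abs_add_le _ _
      _ = 2 * |c| * r + |b| := by rw [abs_mul, abs_mul, abs_two, abs_of_nonneg hr1]
      _ ≤ 2 * c₀ * (2 * (d : ℤ) ^ 2) + c₀ := by gcongr
      _ ≤ c₀ * (5 * (d : ℤ) ^ 2) := by nlinarith
      _ ≤ c₀ * (d * T) := by gcongr
      _ = c₀ * d * T := by ring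
  · intro s hs
    have hs' : (s : ℤ) ≤ T := by exact_mod_cast hs.le
    have hds : (d : ℤ) * s ≤ d * T := by gcongr
    have hds0 : 0 ≤ (d : ℤ) * s := by positivity
    refine (abs_quadVal_le hc₀ hb₀ he₀ (y := 2 * (d * T)) ?_ ?_).trans (le_of_eq ?_)
    · linarith
    · linarith
    · ring

set_option maxHeartbeats 800000 in
/-- The basic iteration step: if the Fourier mass of `A` near frequencies trivial at step `d` is at
least the density, then passing to a multiple of `d` increases this mass by a constant factor. -/
theorem exists_zoneMass_increment {A : Finset ℕ} {c₁ b₁ e₁ c₂ b₂ e₂ R₁ R₂ : ℤ} {c₀ d N : ℕ}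
    {δ σ : ℝ} (hc₁ : c₁ ≠ 0) (hc₁₀ : |c₁| ≤ c₀) (hb₁₀ : |b₁| ≤ c₀) (he₁₀ : |e₁| ≤ c₀)
    (hc₂ : c₂ ≠ 0) (hc₂₀ : |c₂| ≤ c₀) (hb₂₀ : |b₂| ≤ c₀) (he₂₀ : |e₂| ≤ c₀)
    (hN : 0 < N) (hA : A ⊆ Finset.Icc 1 N) (hne : A.Nonempty)
    (hAP : ∀ a ∈ A, ∀ a' ∈ A, a ≠ a' → ∀ x y : ℤ, 1 ≤ x → 1 ≤ y →
      (a : ℤ) - a' ≠ quadVal c₁ b₁ e₁ x + quadVal c₂ b₂ e₂ y)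
    (hd : 0 < d) (hR₁ : (d : ℤ) ^ 2 ∣ quadVal c₁ b₁ e₁ R₁) (hR₂ : (d : ℤ) ^ 2 ∣ quadVal c₂ b₂ e₂ R₂)
    (hδ : 0 < δ) (hδ1 : δ ≤ 1) (hσ : 0 < σ) (hσN : 1 ≤ σ ^ 2 * N)
    (hsmall : 2 * 10 ^ 15 * (c₀ : ℝ) ^ 4 * d ^ 2 * σ ≤ δ ^ 9)
    (hmass : δ ≤ zoneMass A N (2 * c₁ * R₁ + b₁) (2 * c₂ * R₂ + b₂) d σ) :
    ∃ u : ℕ, 0 < u ∧ (u : ℝ) ≤ 128 * c₀ / δ ∧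
      (1 + 1 / (128 * c₀)) * zoneMass A N (2 * c₁ * R₁ + b₁) (2 * c₂ * R₂ + b₂) d σ
        ≤ zoneMass A N (2 * c₁ * R₁ + b₁) (2 * c₂ * R₂ + b₂) (d * u)
          (10 ^ 6 * c₀ ^ 2 / δ ^ 3 * σ) := by
  classical
  have hc₀ : 1 ≤ c₀ := by exact_mod_cast (Int.one_le_abs hc₁).trans hc₁₀
  have hc₀R : (1 : ℝ) ≤ c₀ := by exact_mod_cast hc₀
  have hdR : (0 : ℝ) < d := by exact_mod_cast hd
  obtain ⟨T, hT1, hT2, hT3, hT4, hT5⟩ := exists_length_of_scale hc₀ hd hδ hδ1 hσ hsmall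
  have hT : 0 < T := by omega
  have hTR : (0 : ℝ) < T := by exact_mod_cast hT
  obtain ⟨r₁, hr₁, hr₁R, hr₁b, hr₁v⟩ := exists_base_point (R := R₁) hc₁₀ hb₁₀ he₁₀ hd hT5
  obtain ⟨r₂, hr₂, hr₂R, hr₂b, hr₂v⟩ := exists_base_point (R := R₂) hc₂₀ hb₂₀ he₂₀ hd hT5
  set P₁ : ℕ → ℤ := fun s => quadVal c₁ b₁ e₁ (r₁ + d * s) with hP₁
  set P₂ : ℕ → ℤ := fun s => quadVal c₂ b₂ e₂ (r₂ + d * s) with hP₂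
  have hbound : ∀ s < T, ∀ t < T, |P₁ s + P₂ t| ≤ 24 * c₀ * (d * T) ^ 2 := by
    intro s hs t ht
    have h := abs_add_le (P₁ s) (P₂ t)
    linarith [hr₁v s hs, hr₂v t ht]
  have hboundR : ∀ s < T, ∀ t < T, σ ^ 2 * |((P₁ s + P₂ t : ℤ) : ℝ)| ≤ 3 / 50 := by
    intro s hs t ht
    have h1 : |((P₁ s + P₂ t : ℤ) : ℝ)| ≤ 24 * c₀ * (d * T) ^ 2 := by
      exact_mod_cast hbound s hs t ht
    have h2 : (20 * c₀ * d * σ * T) ^ 2 ≤ 1 := pow_le_one₀ (by positivity) hT1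
    have h3 : (20 * c₀ * d * σ * T) ^ 2 = 400 * c₀ ^ 2 * ((d * T) ^ 2 * σ ^ 2) := by ring
    have h4 : (c₀ : ℝ) * ((d * T) ^ 2 * σ ^ 2) ≤ c₀ ^ 2 * ((d * T) ^ 2 * σ ^ 2) := by
      gcongr
      exact le_self_pow₀ hc₀R (by norm_num)
    calc σ ^ 2 * |((P₁ s + P₂ t : ℤ) : ℝ)| ≤ σ ^ 2 * (24 * c₀ * (d * T) ^ 2) := by gcongr
      _ ≤ 3 / 50 := by linarith
  have hboundN : ∀ s < T, ∀ t < T, |P₁ s + P₂ t| ≤ N := by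
    intro s hs t ht
    have h1 : σ ^ 2 * |((P₁ s + P₂ t : ℤ) : ℝ)| ≤ σ ^ 2 * N := by
      linarith [hboundR s hs t ht]
    exact_mod_cast le_of_mul_le_mul_left h1 (by positivity)
  have hK : (1 : ℝ) ≤ 16 * c₀ := by linarith
  have hscale : 1 ≤ 10 ^ 6 * (c₀ : ℝ) ^ 2 / δ ^ 3 := by
    rw [le_div_iff₀ (by positivity)]
    have h1 : δ ^ 3 ≤ 1 := pow_le_one₀ hδ.le hδ1
    have h2 : (1 : ℝ) ≤ c₀ ^ 2 := one_le_pow₀ hc₀R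
    linarith
  have hσσ' : σ ≤ 10 ^ 6 * c₀ ^ 2 / δ ^ 3 * σ := le_mul_of_one_le_left hσ.le hscale
  have hstep := exists_mass_increment (Finset.range (2 * N)) (ν := fourierMass A N)
    (F := fun j => progressionSum P₁ P₂ T ((j : ℝ) / (2 * N : ℕ)))
    (Z := fun j => NearTrivial (2 * c₁ * R₁ + b₁) (2 * c₂ * R₂ + b₂) d σ ((j : ℝ) / (2 * N : ℕ)))
    (Z' := fun u j => NearTrivial (2 * c₁ * R₁ + b₁) (2 * c₂ * R₂ + b₂) (d * u)
      (10 ^ 6 * c₀ ^ 2 / δ ^ 3 * σ) ((j : ℝ) / (2 * N : ℕ)))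
    (fourierMass_nonneg A N) (sum_fourierMass hN hA hne) hK hδ hδ1 ?_ ?_
    (fun j _ hj u _ => hj.mul u hσ.le hσσ') ?_ hmass
  · obtain ⟨u, hu, huQ, hM⟩ := hstep
    refine ⟨u, hu, huQ.trans (le_of_eq (by ring)), ?_⟩
    have h128 : (128 : ℝ) * c₀ = 8 * (16 * c₀) := by ring
    rw [h128]
    exact hM
  · refine (sum_fourierMass_mul_re_progressionSum_le (k := 2) hN hA hne hT hboundN ?_
      fun y => card_filter_quadVal_eq_le hc₁ hd r₁ y T).trans ?_
    · intro a ha a' ha' haa' s t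
      exact hAP a ha a' ha' haa' _ _ (by linarith [show 0 ≤ (d : ℤ) * s by positivity])
        (by linarith [show 0 ≤ (d : ℤ) * t by positivity])
    · rw [div_le_div_iff₀ hTR (by norm_num)]
      push_cast
      linarith
  · rintro j - ⟨γ, h₀, h₁, h₂, hγ⟩
    refine half_le_re_progressionSum hT fun s hs t ht => ?_
    have hdr : ∀ {r R : ℤ}, (d : ℤ) ^ 2 ∣ r - R → ∀ s : ℕ, (d : ℤ) ∣ r + d * s - R := by
      intro r R hr s
      have := (dvd_pow_self (d : ℤ) two_ne_zero).trans hr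
      have h := dvd_add this (dvd_mul_right (d : ℤ) s)
      rwa [show r - R + d * s = r + d * s - R by ring] at h
    obtain ⟨n₁, hn₁⟩ := exists_int_mul_quadVal hR₁ h₀ h₁ (hdr hr₁R s)
    obtain ⟨n₂, hn₂⟩ := exists_int_mul_quadVal hR₂ h₀ h₂ (hdr hr₂R t)
    refine ⟨n₁ + n₂, ?_⟩
    have h3 : (j : ℝ) / (2 * N : ℕ) * (P₁ s + P₂ t : ℤ) - ((n₁ + n₂ : ℤ) : ℝ)
        = ((j : ℝ) / (2 * N : ℕ) - γ) * (P₁ s + P₂ t : ℤ) := by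
      rw [Int.cast_add n₁, ← hn₁, ← hn₂, Int.cast_add (P₁ s)]
      ring
    rw [h3, abs_mul]
    exact (mul_le_mul_of_nonneg_right hγ (abs_nonneg _)).trans (hboundR s hs t ht)
  · intro j _ _ hj
    rw [hP₁, hP₂, norm_progressionSum, le_div_iff₀ (by positivity)] at hj
    obtain ⟨a, m, hm, hbd, hα, hd₁, hd₂⟩ := exists_rational_of_large_product hc₁ hc₂ hc₁₀ hc₂₀ hd
      hr₁b hr₂b (by positivity : 0 < δ / 8) (by linarith) hT3 hj
    have hmR : (0 : ℝ) < m := by exact_mod_cast hm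
    refine ⟨m, hm, ?_, ?_⟩
    · rw [hP₁, hP₂, norm_progressionSum, div_le_iff₀ (by positivity)]
      exact hbd.trans (le_of_eq (by ring))
    · have htrans : ∀ {c b r R : ℤ}, (d : ℤ) ^ 2 ∣ r - R → (d : ℤ) ∣ a * (2 * c * r + b) →
          (d : ℤ) ∣ a * (2 * c * R + b) := by
        intro c b r R hr h
        have h1 := ((dvd_pow_self (d : ℤ) two_ne_zero).trans hr).mul_left (a * (2 * c))
        have h2 := dvd_sub h h1
        rwa [show a * (2 * c * r + b) - a * (2 * c) * (r - R) = a * (2 * c * R + b) by ring] at h2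
      have hα' : |(j : ℝ) / (2 * N : ℕ) - a / (m * d ^ 2)| ≤ (10 ^ 6 * c₀ ^ 2 / δ ^ 3 * σ) ^ 2 := by
        refine hα.trans ?_
        rw [div_le_iff₀ (by positivity)]
        have h1 : 1 ≤ (40 * c₀ * d * σ * T) ^ 2 := one_le_pow₀ hT2
        have h2 : (10 ^ 6 * c₀ ^ 2 / δ ^ 3 * σ) ^ 2 * ((δ / 8) ^ 6 * T ^ 2 * d ^ 2)
            = 10 ^ 12 / (262144 * 1600) * c₀ ^ 2 * (40 * c₀ * d * σ * T) ^ 2 := by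
          field_simp
          ring
        have h3 : (c₀ : ℝ) ≤ c₀ ^ 2 := le_self_pow₀ hc₀R (by norm_num)
        rw [h2]
        calc 1760 * (c₀ : ℝ) ≤ 10 ^ 12 / (262144 * 1600) * c₀ ^ 2 * 1 := by linarith
          _ ≤ _ := by gcongr
      rintro u hu ⟨v, rfl⟩
      have hz := (nearTrivial_of_dvd hd hm (htrans hr₁R hd₁) (htrans hr₂R hd₂) hα').mul v
        (by positivity) le_rfl
      rwa [mul_assoc d m v] at hz

lemma zoneMass_le_one {A : Finset ℕ} {N : ℕ} (hN : 0 < N) (hA : A ⊆ Finset.Icc 1 N)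
    (hne : A.Nonempty) (p₁ p₂ : ℤ) (d : ℕ) (σ : ℝ) : zoneMass A N p₁ p₂ d σ ≤ 1 := by
  classical
  rw [← sum_fourierMass hN hA hne]
  exact Finset.sum_le_sum_of_subset_of_nonneg (Finset.filter_subset _ _)
    fun j _ _ => fourierMass_nonneg A N j

lemma density_le_zoneMass {A : Finset ℕ} {N : ℕ} (hN : 0 < N) (hne : A.Nonempty) (p₁ p₂ : ℤ)
    (d : ℕ) (σ : ℝ) : (A.card : ℝ) / (2 * N : ℕ) ≤ zoneMass A N p₁ p₂ d σ := by
  classical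
  rw [← fourierMass_zero hne N]
  refine Finset.single_le_sum (f := fourierMass A N) (fun j _ => fourierMass_nonneg A N j) ?_
  rw [Finset.mem_filter, Finset.mem_range]
  refine ⟨by omega, 0, ⟨0, by simp⟩, ⟨0, by simp⟩, ⟨0, by simp⟩, ?_⟩
  simpa using sq_nonneg σ

section Iteration

variable {A : Finset ℕ} {c₁ b₁ e₁ c₂ b₂ e₂ : ℤ} {c₀ N : ℕ} {δ : ℝ}

lemma exists_zoneMass_ge {R₁ R₂ : ℤ} (hc₁ : c₁ ≠ 0) (hc₁₀ : |c₁| ≤ c₀) (hb₁₀ : |b₁| ≤ c₀)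
    (he₁₀ : |e₁| ≤ c₀) (hc₂ : c₂ ≠ 0) (hc₂₀ : |c₂| ≤ c₀) (hb₂₀ : |b₂| ≤ c₀) (he₂₀ : |e₂| ≤ c₀)
    (hN : 0 < N) (hA : A ⊆ Finset.Icc 1 N) (hne : A.Nonempty)
    (hAP : ∀ a ∈ A, ∀ a' ∈ A, a ≠ a' → ∀ x y : ℤ, 1 ≤ x → 1 ≤ y →
      (a : ℤ) - a' ≠ quadVal c₁ b₁ e₁ x + quadVal c₂ b₂ e₂ y)
    (hδ : 0 < δ) (hδ1 : δ ≤ 1) (hδA : δ = A.card / (2 * N : ℕ)) {k : ℕ}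
    (hR₁ : ∀ d : ℕ, 0 < d → (d : ℝ) ≤ (128 * c₀ / δ) ^ k → (d : ℤ) ^ 2 ∣ quadVal c₁ b₁ e₁ R₁)
    (hR₂ : ∀ d : ℕ, 0 < d → (d : ℝ) ≤ (128 * c₀ / δ) ^ k → (d : ℤ) ^ 2 ∣ quadVal c₂ b₂ e₂ R₂)
    (hsmall : 2 * 10 ^ 15 * (c₀ : ℝ) ^ 4 * ((128 * c₀ / δ) ^ k) ^ 2 *
      ((10 ^ 6 * c₀ ^ 2 / δ ^ 3) ^ k * (1 / √N)) ≤ δ ^ 9) :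
    ∀ i ≤ k, ∃ d : ℕ, 0 < d ∧ (d : ℝ) ≤ (128 * c₀ / δ) ^ i ∧
      (1 + 1 / (128 * c₀ : ℝ)) ^ i * δ ≤ zoneMass A N (2 * c₁ * R₁ + b₁) (2 * c₂ * R₂ + b₂) d
        ((10 ^ 6 * c₀ ^ 2 / δ ^ 3) ^ i * (1 / √N)) := by
  have hc₀ : (1 : ℝ) ≤ c₀ := by exact_mod_cast (Int.one_le_abs hc₁).trans hc₁₀
  have hNR : (0 : ℝ) < N := by exact_mod_cast hN
  have hx : 1 ≤ 128 * c₀ / δ := by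
    rw [le_div_iff₀ hδ]
    linarith
  have hy : 1 ≤ 10 ^ 6 * (c₀ : ℝ) ^ 2 / δ ^ 3 := by
    rw [le_div_iff₀ (by positivity)]
    have h1 : δ ^ 3 ≤ 1 := pow_le_one₀ hδ.le hδ1
    have h2 : (1 : ℝ) ≤ c₀ ^ 2 := one_le_pow₀ hc₀
    linarith
  intro i
  induction i with
  | zero =>
    intro _
    refine ⟨1, one_pos, by simp, ?_⟩
    rw [pow_zero, one_mul, hδA]
    exact density_le_zoneMass hN hne _ _ _ _
  | succ i ih =>
    intro hi
    obtain ⟨d, hd, hdi, hM⟩ := ih (by omega)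
    have hdk : (d : ℝ) ≤ (128 * c₀ / δ) ^ k :=
      hdi.trans (pow_le_pow_right₀ hx (by omega))
    have hyi : (10 ^ 6 * (c₀ : ℝ) ^ 2 / δ ^ 3) ^ i ≤ (10 ^ 6 * (c₀ : ℝ) ^ 2 / δ ^ 3) ^ k :=
      pow_le_pow_right₀ hy (by omega)
    have hδM : δ ≤ (1 + 1 / (128 * c₀ : ℝ)) ^ i * δ := by
      refine le_mul_of_one_le_left hδ.le (one_le_pow₀ ?_)
      have : 0 ≤ 1 / (128 * c₀ : ℝ) := by positivity
      linarith
    have hσN : 1 ≤ ((10 ^ 6 * (c₀ : ℝ) ^ 2 / δ ^ 3) ^ i * (1 / √N)) ^ 2 * N := by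
      have h1 : ((10 ^ 6 * (c₀ : ℝ) ^ 2 / δ ^ 3) ^ i * (1 / √N)) ^ 2 * N
          = ((10 ^ 6 * (c₀ : ℝ) ^ 2 / δ ^ 3) ^ i) ^ 2 := by
        rw [mul_pow _ (1 / √(N : ℝ)), div_pow 1, Real.sq_sqrt hNR.le, one_pow, mul_assoc,
          one_div_mul_cancel hNR.ne', mul_one]
      rw [h1]
      exact one_le_pow₀ (one_le_pow₀ hy)
    have hsm : 2 * 10 ^ 15 * (c₀ : ℝ) ^ 4 * d ^ 2 *
        ((10 ^ 6 * (c₀ : ℝ) ^ 2 / δ ^ 3) ^ i * (1 / √N))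
        ≤ 2 * 10 ^ 15 * (c₀ : ℝ) ^ 4 * ((128 * c₀ / δ) ^ k) ^ 2 *
          ((10 ^ 6 * c₀ ^ 2 / δ ^ 3) ^ k * (1 / √N)) := by
      gcongr
    obtain ⟨u, hu, huQ, hinc⟩ := exists_zoneMass_increment
      (σ := (10 ^ 6 * c₀ ^ 2 / δ ^ 3) ^ i * (1 / √N)) hc₁ hc₁₀ hb₁₀ he₁₀ hc₂ hc₂₀ hb₂₀
      he₂₀ hN hA hne hAP hd (hR₁ d hd hdk) (hR₂ d hd hdk) hδ hδ1 (by positivity) hσN (hsm.trans hsmall)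
      (hδM.trans hM)
    refine ⟨d * u, Nat.mul_pos hd hu, ?_, ?_⟩
    · rw [pow_succ, Nat.cast_mul]
      gcongr
    · have h1 : (10 ^ 6 * (c₀ : ℝ) ^ 2 / δ ^ 3) ^ (i + 1) * (1 / √N)
          = 10 ^ 6 * c₀ ^ 2 / δ ^ 3 * ((10 ^ 6 * c₀ ^ 2 / δ ^ 3) ^ i * (1 / √N)) := by ring
      rw [h1]
      refine le_trans ?_ hinc
      calc (1 + 1 / (128 * c₀ : ℝ)) ^ (i + 1) * δ
          = (1 + 1 / (128 * c₀ : ℝ)) * ((1 + 1 / (128 * c₀ : ℝ)) ^ i * δ) := by ring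
        _ ≤ _ := by gcongr

lemma pow_mul_density_le_one {g h : ℤ → ℤ} (hg : g = quadVal c₁ b₁ e₁) (hh : h = quadVal c₂ b₂ e₂)
    (hgi : ∀ q : ℕ, 0 < q → ∃ n : ℤ, (q : ℤ) ∣ g n) (hhi : ∀ q : ℕ, 0 < q → ∃ n : ℤ, (q : ℤ) ∣ h n)
    (hc₁ : c₁ ≠ 0) (hc₁₀ : |c₁| ≤ c₀) (hb₁₀ : |b₁| ≤ c₀)
    (he₁₀ : |e₁| ≤ c₀) (hc₂ : c₂ ≠ 0) (hc₂₀ : |c₂| ≤ c₀) (hb₂₀ : |b₂| ≤ c₀) (he₂₀ : |e₂| ≤ c₀)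
    (hN : 0 < N) (hA : A ⊆ Finset.Icc 1 N) (hne : A.Nonempty)
    (hAP : ∀ a ∈ A, ∀ a' ∈ A, a ≠ a' → ∀ x y : ℤ, 1 ≤ x → 1 ≤ y → (a : ℤ) - a' ≠ g x + h y)
    (hδ : 0 < δ) (hδ1 : δ ≤ 1) (hδA : δ = A.card / (2 * N : ℕ)) {k : ℕ}
    (hk : (2 * 10 ^ 15 * c₀ ^ 4 / δ) ^ (5 * k + 9) ≤ √N) :
    (1 + 1 / (128 * c₀ : ℝ)) ^ k * δ ≤ 1 := by
  subst hg hh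
  have hc₀ : (1 : ℝ) ≤ c₀ := by exact_mod_cast (Int.one_le_abs hc₁).trans hc₁₀
  have hc₀0 : (0 : ℝ) < c₀ := by linarith
  have hNs : 0 < √(N : ℝ) := Real.sqrt_pos.mpr (by exact_mod_cast hN)
  have hfact : ∀ {f : ℤ → ℤ}, (∀ q : ℕ, 0 < q → ∃ n : ℤ, (q : ℤ) ∣ f n) →
      ∃ R : ℤ, ∀ d : ℕ, 0 < d → (d : ℝ) ≤ (128 * c₀ / δ) ^ k → (d : ℤ) ^ 2 ∣ f R := by
    intro f hf
    obtain ⟨R, hR⟩ := hf ((⌊(128 * c₀ / δ) ^ k⌋₊.factorial) ^ 2) (by positivity)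
    refine ⟨R, fun d hd hdk => dvd_trans ?_ hR⟩
    have := Nat.dvd_factorial hd (Nat.le_floor hdk)
    exact_mod_cast pow_dvd_pow_of_dvd this 2
  obtain ⟨R₁, hR₁⟩ := hfact hgi
  obtain ⟨R₂, hR₂⟩ := hfact hhi
  have hsmall : 2 * 10 ^ 15 * (c₀ : ℝ) ^ 4 * ((128 * c₀ / δ) ^ k) ^ 2 *
      ((10 ^ 6 * c₀ ^ 2 / δ ^ 3) ^ k * (1 / √N)) ≤ δ ^ 9 := by
    set K : ℝ := 2 * 10 ^ 15 * c₀ ^ 4 with hK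
    have hc4 : (1 : ℝ) ≤ c₀ ^ 4 := one_le_pow₀ hc₀
    have hK1 : 1 ≤ K := by rw [hK]; linarith
    have h1 : 128 * c₀ / δ ≤ K / δ := by
      have : (c₀ : ℝ) ≤ c₀ ^ 4 := le_self_pow₀ hc₀ (by norm_num)
      gcongr
      rw [hK]
      linarith
    have h2 : 10 ^ 6 * (c₀ : ℝ) ^ 2 / δ ^ 3 ≤ (K / δ) ^ 3 := by
      rw [div_pow]
      gcongr
      have h3 : (c₀ : ℝ) ^ 2 ≤ c₀ ^ 4 := pow_le_pow_right₀ hc₀ (by norm_num)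
      have h4 : K ≤ K ^ 3 := le_self_pow₀ hK1 (by norm_num)
      refine le_trans ?_ h4
      rw [hK]
      linarith
    have h3 : K ≤ (K / δ) ^ 9 * δ ^ 9 := by
      rw [div_pow, div_mul_cancel₀ _ (by positivity)]
      exact le_self_pow₀ hK1 (by norm_num)
    calc K * ((128 * c₀ / δ) ^ k) ^ 2 * ((10 ^ 6 * c₀ ^ 2 / δ ^ 3) ^ k * (1 / √N))
        ≤ ((K / δ) ^ 9 * δ ^ 9) * ((K / δ) ^ k) ^ 2 * (((K / δ) ^ 3) ^ k * (1 / √N)) := by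
          gcongr
      _ = (K / δ) ^ (5 * k + 9) / √N * δ ^ 9 := by
          rw [← pow_mul, ← pow_mul, pow_add, pow_mul' _ 5 k]
          ring
      _ ≤ 1 * δ ^ 9 := by
          gcongr
          rw [div_le_one hNs]
          exact hk
      _ = δ ^ 9 := one_mul _
  obtain ⟨d, _, _, hM⟩ := exists_zoneMass_ge hc₁ hc₁₀ hb₁₀ he₁₀ hc₂ hc₂₀ hb₂₀ he₂₀ hN hA hne hAP
    hδ hδ1 hδA hR₁ hR₂ hsmall k le_rfl
  exact hM.trans (zoneMass_le_one hN hA hne _ _ _ _)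

end Iteration

lemma le_mul_exp_neg_sqrt_log {K δ ρ N : ℝ} (hK : Real.exp 1 ≤ K) (hδ : 0 < δ) (hδ1 : δ ≤ 1)
    (hρ : 1 < ρ) (hN : 1 ≤ N) (h : ∀ k : ℕ, (K / δ) ^ (5 * k + 9) ≤ √N → ρ ^ k * δ ≤ 1) :
    δ ≤ K * Real.exp (-(1 / √(2 * (14 + 5 / Real.log ρ))) * √(Real.log N)) := by
  have hK0 : 0 < K := (Real.exp_pos 1).trans_le hK
  have hρl : 0 < Real.log ρ := Real.log_pos hρ
  have hE0 : 0 < K / δ := by positivity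
  have hKE : K ≤ K / δ := by
    rw [le_div_iff₀ hδ]
    exact mul_le_of_le_one_right hK0.le hδ1
  have hl1 : 1 ≤ Real.log (K / δ) := by
    rw [Real.le_log_iff_exp_le hE0]
    exact hK.trans hKE
  have hlδ0 : 0 ≤ Real.log (1 / δ) := Real.log_nonneg (by rw [le_div_iff₀ hδ]; linarith)
  have hlδ : Real.log (1 / δ) ≤ Real.log (K / δ) := by
    refine Real.log_le_log (by positivity) ?_
    gcongr
    linarith [Real.add_one_le_exp (1 : ℝ)]
  set l := Real.log (K / δ) with hl
  set k := ⌊Real.log (1 / δ) / Real.log ρ⌋₊ + 1 with hk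
  have hk1 : Real.log (1 / δ) < k * Real.log ρ := by
    rw [← div_lt_iff₀ hρl, hk]
    exact_mod_cast Nat.lt_floor_add_one (Real.log (1 / δ) / Real.log ρ)
  have hk2 : (k : ℝ) ≤ l / Real.log ρ + 1 := by
    have : (⌊Real.log (1 / δ) / Real.log ρ⌋₊ : ℝ) ≤ Real.log (1 / δ) / Real.log ρ :=
      Nat.floor_le (by positivity)
    rw [hk]
    push_cast
    have h2 : Real.log (1 / δ) / Real.log ρ ≤ l / Real.log ρ := by gcongr
    linarith
  have hbig : 1 < ρ ^ k * δ := by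
    rw [← div_lt_iff₀ hδ, ← Real.log_lt_log_iff (by positivity) (by positivity), Real.log_pow]
    exact hk1
  have hsqrt : √N < (K / δ) ^ (5 * k + 9) := by
    by_contra! hle
    exact absurd (h k hle) (not_le.mpr hbig)
  have hlog : Real.log N / 2 < ((5 * k + 9 : ℕ) : ℝ) * l := by
    have h1 := Real.log_lt_log (Real.sqrt_pos.mpr (by linarith)) hsqrt
    rwa [Real.log_sqrt (by linarith), Real.log_pow] at h1
  set B := 2 * (14 + 5 / Real.log ρ) with hB
  have hB0 : 0 < B := by positivity
  have hfin : Real.log N ≤ B * l ^ 2 := by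
    have h1 : ((5 * k + 9 : ℕ) : ℝ) ≤ (14 + 5 / Real.log ρ) * l := by
      push_cast
      have h2 : 5 * (l / Real.log ρ) = 5 / Real.log ρ * l := by ring
      nlinarith
    have h2 : ((5 * k + 9 : ℕ) : ℝ) * l ≤ (14 + 5 / Real.log ρ) * l * l := by gcongr
    rw [hB]
    nlinarith
  have hsl : 1 / √B * √(Real.log N) ≤ l := by
    rw [one_div_mul_eq_div, div_le_iff₀ (Real.sqrt_pos.mpr hB0)]
    refine (Real.sqrt_le_sqrt hfin).trans (le_of_eq ?_)
    rw [Real.sqrt_mul hB0.le, Real.sqrt_sq (by linarith), mul_comm]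
  have hexp : Real.exp (1 / √B * √(Real.log N)) ≤ K / δ := by
    rwa [← Real.le_log_iff_exp_le hE0]
  rw [neg_mul, Real.exp_neg, ← div_eq_mul_inv, le_div_iff₀ (Real.exp_pos _)]
  rw [le_div_iff₀ hδ] at hexp
  linarith

lemma eval_eq_quadVal {g : Polynomial ℤ} (hg : g.natDegree = 2) (x : ℤ) :
    g.eval x = quadVal (g.coeff 2) (g.coeff 1) (g.coeff 0) x := by
  rw [Polynomial.eval_eq_sum_range, hg, Finset.sum_range_succ, Finset.sum_range_succ,
    Finset.sum_range_one, quadVal]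
  ring

/-- If `g, h ∈ ℤ[x]` are nonzero intersective polynomials of degree `2`, then there are
`c, C > 0` such that any `A ⊆ {1,…,N}` with no difference of distinct elements of the form
`g(m)+h(n)`, `m, n ≥ 1`, satisfies `|A| ≤ C · N · exp(-c (log N)^{1/2})`. -/
theorem sum_of_two_intersective_quadratics
    (g h : Polynomial ℤ) (hg : Intersective g) (hh : Intersective h)
    (hgdeg : g.natDegree = 2) (hhdeg : h.natDegree = 2) :
    ∃ c C : ℝ, 0 < c ∧ 0 < C ∧
      ∀ N : ℕ, 2 ≤ N → ∀ A : Finset ℕ, A ⊆ Finset.Icc 1 N →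
        (∀ a ∈ A, ∀ a' ∈ A, a ≠ a' → ∀ m n : ℕ, 1 ≤ m → 1 ≤ n →
          (a : ℤ) - (a' : ℤ) ≠ g.eval (m : ℤ) + h.eval (n : ℤ)) →
        (A.card : ℝ) ≤ C * N * Real.exp (-c * Real.log N ^ ((1 : ℝ) / 2)) := by
  obtain ⟨c₀, hc₀⟩ : ∃ c₀ : ℕ, ∀ i < 3, |g.coeff i| ≤ c₀ ∧ |h.coeff i| ≤ c₀ := by
    refine ⟨∑ i ∈ Finset.range 3, ((g.coeff i).natAbs + (h.coeff i).natAbs), fun i hi => ?_⟩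
    have := Finset.single_le_sum (f := fun i => (g.coeff i).natAbs + (h.coeff i).natAbs)
      (fun _ _ => Nat.zero_le _) (Finset.mem_range.mpr hi)
    constructor <;> rw [Int.abs_eq_natAbs] <;> exact_mod_cast (by omega)
  have hlead : ∀ {f : Polynomial ℤ}, f ≠ 0 → f.natDegree = 2 → f.coeff 2 ≠ 0 := by
    intro f hf hdeg
    rw [← hdeg]
    exact Polynomial.leadingCoeff_ne_zero.mpr hf
  have hg2 := hlead hg.1 hgdeg
  have hh2 := hlead hh.1 hhdeg
  have hc₀1 : (1 : ℝ) ≤ c₀ := by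
    exact_mod_cast (Int.one_le_abs hg2).trans (hc₀ 2 (by norm_num)).1
  have hρ : 1 < 1 + 1 / (128 * c₀ : ℝ) := by
    have : 0 < 1 / (128 * c₀ : ℝ) := by positivity
    linarith
  have hρl : 0 < Real.log (1 + 1 / (128 * c₀ : ℝ)) := Real.log_pos hρ
  have hK : Real.exp 1 ≤ 2 * 10 ^ 15 * (c₀ : ℝ) ^ 4 := by
    have h1 := Real.exp_one_lt_d9
    have h2 : (1 : ℝ) ≤ c₀ ^ 4 := one_le_pow₀ hc₀1
    linarith
  refine ⟨1 / √(2 * (14 + 5 / Real.log (1 + 1 / (128 * c₀ : ℝ)))), 2 * (2 * 10 ^ 15 * (c₀ : ℝ) ^ 4),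
    by positivity, by positivity, fun N hN A hA hAP => ?_⟩
  rcases A.eq_empty_or_nonempty with rfl | hne
  · simp only [Finset.card_empty, Nat.cast_zero]
    positivity
  have hN0 : 0 < N := by omega
  have hNR : (0 : ℝ) < N := by exact_mod_cast hN0
  have hAcard : (A.card : ℝ) ≤ N := by
    exact_mod_cast (Finset.card_le_card hA).trans (by simp)
  have hAcard0 : (0 : ℝ) < A.card := by exact_mod_cast hne.card_pos
  set δ : ℝ := A.card / (2 * N : ℕ) with hδ
  have hδ0 : 0 < δ := by positivity
  have hδ1 : δ ≤ 1 := by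
    rw [hδ, div_le_one (by positivity)]
    push_cast
    linarith
  have hAδ : (A.card : ℝ) = 2 * N * δ := by
    rw [hδ]
    push_cast
    field_simp
  have hbound := le_mul_exp_neg_sqrt_log hK hδ0 hδ1 hρ (by exact_mod_cast hN0 : (1 : ℝ) ≤ N)
    fun k hk => pow_mul_density_le_one (g := fun x => g.eval x) (h := fun x => h.eval x)
      (funext (eval_eq_quadVal hgdeg)) (funext (eval_eq_quadVal hhdeg))
      (fun q hq => let ⟨n, _, hn⟩ := hg.2 q hq; ⟨n, hn⟩)
      (fun q hq => let ⟨n, _, hn⟩ := hh.2 q hq; ⟨n, hn⟩)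
      hg2 (hc₀ 2 (by norm_num)).1 (hc₀ 1 (by norm_num)).1 (hc₀ 0 (by norm_num)).1
      hh2 (hc₀ 2 (by norm_num)).2 (hc₀ 1 (by norm_num)).2 (hc₀ 0 (by norm_num)).2 hN0 hA hne
      (fun a ha a' ha' haa' x y hx hy => by
        lift x to ℕ using by linarith
        lift y to ℕ using by linarith
        exact hAP a ha a' ha' haa' x y (by exact_mod_cast hx) (by exact_mod_cast hy))
      hδ0 hδ1 hδ hk
  rw [← Real.sqrt_eq_rpow, hAδ]
  calc 2 * N * δ ≤ 2 * N * _ := mul_le_mul_of_nonneg_left hbound (by positivity)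
    _ = _ := by ring
end

section
/- Let h ∈ ℤ[x] be a polynomial with positive leading coefficient, let d, q, λ_d, λ_q be positive integers, let r, r' be integers with −d < r ≤ 0, −qd < r' ≤ 0, and d ∣ (r' − r), and let H, H' ∈ ℤ[x] be polynomials satisfying the polynomial identities h(r + d·x) = λ_d · H(x) and h(r' + qd·x) = λ_d · λ_q · H'(x). Suppose A ⊆ ℕ satisfies (A − A) ∩ I(H) = ∅. Then for every integer x₀ and every set A' ⊆ {a ∈ ℕ : x₀ + λ_q·a ∈ A}, one has (A' − A') ∩ I(H') = ∅. -/
/-- For a nonzero `P ∈ ℤ[x]`, `Iset P` is the set of positive values `P(n)`, `n ≥ 1`,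
if the leading coefficient of `P` is positive, and the set of negative such values if the
leading coefficient is negative. -/
def Iset (P : Polynomial ℤ) : Set ℤ :=
  if 0 < P.leadingCoeff then {y | ∃ n : ℕ, 1 ≤ n ∧ P.eval (n : ℤ) = y ∧ 0 < y}
  else {y | ∃ n : ℕ, 1 ≤ n ∧ P.eval (n : ℤ) = y ∧ y < 0}

/-- The difference set `A - A ⊆ ℤ` of a set `A ⊆ ℕ`. -/
def diffSet (A : Set ℕ) : Set ℤ := {x | ∃ a ∈ A, ∃ a' ∈ A, (a : ℤ) - (a' : ℤ) = x}

/-- If `h` precomposed with an increasing affine map is a positive multiple of `P`, then `P`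
inherits the positivity of the leading coefficient of `h`. -/
lemma leadingCoeff_pos_of_comp_linear_eq {h P : Polynomial ℤ} (hlead : 0 < h.leadingCoeff)
    {r m c : ℤ} (hm : 0 < m) (hc : 0 < c)
    (hP : h.comp (Polynomial.C r + Polynomial.C m * Polynomial.X) = Polynomial.C c * P) :
    0 < P.leadingCoeff := by
  have hlc := congrArg Polynomial.leadingCoeff hP
  rw [add_comm, Polynomial.leadingCoeff_comp
      (by rw [Polynomial.natDegree_linear hm.ne']; exact one_ne_zero),
    Polynomial.leadingCoeff_linear hm.ne', Polynomial.leadingCoeff_mul,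
    Polynomial.leadingCoeff_C] at hlc
  have hpos : 0 < c * P.leadingCoeff := hlc ▸ mul_pos hlead (pow_pos hm _)
  exact pos_of_mul_pos_right hpos hc.le

/-- `Iset P` consists of the positive values of `P` when its leading coefficient is positive. -/
lemma mem_Iset_of_leadingCoeff_pos {P : Polynomial ℤ} (hP : 0 < P.leadingCoeff) {y : ℤ} :
    y ∈ Iset P ↔ ∃ n : ℕ, 1 ≤ n ∧ P.eval (n : ℤ) = y ∧ 0 < y := by
  simp only [Iset, if_pos hP, Set.mem_ofPred_eq]

/-- **Inheritance of the lack of polynomial differences (single polynomial).** -/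
theorem inheritance_single
    (h : Polynomial ℤ) (hlead : 0 < h.leadingCoeff)
    (d q lamd lamq : ℕ) (hd : 0 < d) (hq : 0 < q) (hlamd : 0 < lamd) (hlamq : 0 < lamq)
    (r r' : ℤ) (hr1 : -(d : ℤ) < r) (hr2 : r ≤ 0)
    (hr1' : -((q : ℤ) * d) < r') (hr2' : r' ≤ 0) (hdr : (d : ℤ) ∣ (r' - r))
    (H H' : Polynomial ℤ)
    (hH : h.comp (Polynomial.C r + Polynomial.C (d : ℤ) * Polynomial.X)
        = Polynomial.C ((lamd : ℤ)) * H)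
    (hH' : h.comp (Polynomial.C r' + Polynomial.C ((q : ℤ) * d) * Polynomial.X)
        = Polynomial.C ((lamd : ℤ) * (lamq : ℤ)) * H')
    (A : Set ℕ) (hA : diffSet A ∩ Iset H = ∅)
    (x₀ : ℤ) (A' : Set ℕ)
    (hA' : A' ⊆ {a : ℕ | ∃ b ∈ A, (b : ℤ) = x₀ + (lamq : ℤ) * a}) :
    diffSet A' ∩ Iset H' = ∅ := by
  have hd' : (0 : ℤ) < d := by exact_mod_cast hd
  have hq' : (0 : ℤ) < q := by exact_mod_cast hq
  have hlamd' : (0 : ℤ) < lamd := by exact_mod_cast hlamd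
  have hlamq' : (0 : ℤ) < lamq := by exact_mod_cast hlamq
  have hHpos := leadingCoeff_pos_of_comp_linear_eq hlead hd' hlamd' hH
  have hHpos' := leadingCoeff_pos_of_comp_linear_eq hlead (mul_pos hq' hd')
    (mul_pos hlamd' hlamq') hH'
  rw [Set.eq_empty_iff_forall_notMem]
  rintro y ⟨⟨a, ha, a', ha', hy⟩, hyI⟩
  obtain ⟨n, hn, hev, hy0⟩ := (mem_Iset_of_leadingCoeff_pos hHpos').1 hyI
  obtain ⟨b, hb, hbx⟩ := hA' ha
  obtain ⟨b', hb', hbx'⟩ := hA' ha'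
  obtain ⟨k, hk⟩ := hdr
  have hn' : (1 : ℤ) ≤ n := by exact_mod_cast hn
  have hm : 0 < k + q * n := by
    have hqd : (q : ℤ) * d ≤ q * d * n := le_mul_of_one_le_right (mul_pos hq' hd').le hn'
    have : 0 < (d : ℤ) * (k + q * n) := by linarith
    exact pos_of_mul_pos_right this hd'.le
  have hval : H.eval (k + q * n) = lamq * y := by
    have e := congrArg (Polynomial.eval (k + q * n : ℤ)) hH
    have e' := congrArg (Polynomial.eval (n : ℤ)) hH'
    simp only [Polynomial.eval_comp, Polynomial.eval_add, Polynomial.eval_mul,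
      Polynomial.eval_C, Polynomial.eval_X] at e e'
    have harg : r + d * (k + q * n) = r' + q * d * n := by linear_combination -hk
    rw [harg, e', hev, mul_assoc] at e
    exact (mul_left_cancel₀ hlamd'.ne' e).symm
  refine Set.eq_empty_iff_forall_notMem.1 hA (lamq * y)
    ⟨⟨b, hb, b', hb', by rw [hbx, hbx', ← hy]; ring⟩, ?_⟩
  refine (mem_Iset_of_leadingCoeff_pos hHpos).2
    ⟨(k + q * n).toNat, by omega, ?_, mul_pos hlamq' hy0⟩
  rw [Int.toNat_of_nonneg hm.le, hval]
end

section
/- Let ℓ ≥ 1 and let Λ be a positive integer. For each i = 1,…,ℓ let h_i ∈ ℤ[x] be a nonzero polynomial, let d_i, q_i, λ_i be positive integers, let r_i, r_i' be integers with −d_i < r_i ≤ 0, −q_i d_i < r_i' ≤ 0, and d_i ∣ (r_i' − r_i), and let H_i, H_i' ∈ ℤ[x] satisfy the polynomial identities h_i(r_i + d_i·x) = λ_i · H_i(x) and h_i(r_i' + q_i d_i·x) = λ_i · Λ · H_i'(x). Suppose A ⊆ ℕ satisfies (A − A) ∩ (I(H₁) + ⋯ + I(H_ℓ)) ⊆ {0}.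 Then for every integer x₀ and every set A' ⊆ {a ∈ ℕ : x₀ + Λ·a ∈ A}, one has (A' − A') ∩ (I(H₁') + ⋯ + I(H_ℓ')) ⊆ {0}. -/
/-- The sumset `X₁ + ⋯ + X_ℓ` of a family of sets of integers. -/
def sumsetFam {l : ℕ} (X : Fin l → Set ℤ) : Set ℤ :=
  {x | ∃ f : Fin l → ℤ, (∀ i, f i ∈ X i) ∧ x = ∑ i, f i}

/-- Composing with `c + k * X`, `k > 0`, and dividing by a positive integer preserves the sign of
the leading coefficient. -/
theorem leadingCoeff_pos_iff_of_comp_linear_eq {P Q : Polynomial ℤ} {c k m : ℤ}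
    (hk : 0 < k) (hm : 0 < m)
    (hPQ : P.comp (Polynomial.C c + Polynomial.C k * Polynomial.X) = Polynomial.C m * Q) :
    0 < Q.leadingCoeff ↔ 0 < P.leadingCoeff := by
  have hlin : Polynomial.C c + Polynomial.C k * Polynomial.X
      = Polynomial.C k * Polynomial.X + Polynomial.C c := add_comm _ _
  have hlc := congrArg Polynomial.leadingCoeff hPQ
  rw [hlin, Polynomial.leadingCoeff_comp (by rw [Polynomial.natDegree_linear hk.ne']; simp),
    Polynomial.leadingCoeff_linear hk.ne', Polynomial.leadingCoeff_mul,
    Polynomial.leadingCoeff_C] at hlc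
  rw [← mul_pos_iff_of_pos_left hm, ← hlc, mul_pos_iff_of_pos_right (pow_pos hk _)]

/-- If `P(r + d x) = k Q(x)` and `P(r' + q d x) = k m Q'(x)` with `d ∣ r' - r`, then
`m * I(Q') ⊆ I(Q)`. -/
theorem mul_mem_Iset_of_comp_linear_eq {P Q Q' : Polynomial ℤ} {d q k m : ℕ} {r r' : ℤ}
    (hd : 0 < d) (hq : 0 < q) (hk : 0 < k) (hm : 0 < m) (hr : r ≤ 0)
    (hr' : -((q : ℤ) * (d : ℤ)) < r') (hdr : (d : ℤ) ∣ r' - r)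
    (hQ : P.comp (Polynomial.C r + Polynomial.C (d : ℤ) * Polynomial.X)
      = Polynomial.C (k : ℤ) * Q)
    (hQ' : P.comp (Polynomial.C r' + Polynomial.C ((q : ℤ) * (d : ℤ)) * Polynomial.X)
      = Polynomial.C ((k : ℤ) * (m : ℤ)) * Q')
    {y : ℤ} (hy : y ∈ Iset Q') : (m : ℤ) * y ∈ Iset Q := by
  have hd' : (0 : ℤ) < d := by exact_mod_cast hd
  have hq' : (0 : ℤ) < q := by exact_mod_cast hq
  have hk' : (0 : ℤ) < k := by exact_mod_cast hk
  have hm' : (0 : ℤ) < m := by exact_mod_cast hm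
  have hsign : 0 < Q.leadingCoeff ↔ 0 < Q'.leadingCoeff :=
    (leadingCoeff_pos_iff_of_comp_linear_eq hd' hk' hQ).trans
      (leadingCoeff_pos_iff_of_comp_linear_eq (mul_pos hq' hd') (mul_pos hk' hm') hQ').symm
  have key : ∀ n : ℕ, 1 ≤ n →
      ∃ j : ℕ, 1 ≤ j ∧ Q.eval (j : ℤ) = (m : ℤ) * Q'.eval (n : ℤ) := by
    intro n hn
    obtain ⟨s, hs⟩ := hdr
    have hn' : (1 : ℤ) ≤ n := by exact_mod_cast hn
    have hpos : 0 < (q : ℤ) * n + s := by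
      refine pos_of_mul_pos_right (a := (d : ℤ)) ?_ hd'.le
      nlinarith [mul_le_mul_of_nonneg_left hn' (mul_pos hq' hd').le]
    obtain ⟨j, hj⟩ := Int.eq_ofNat_of_zero_le hpos.le
    refine ⟨j, by omega, ?_⟩
    have e1 := congrArg (Polynomial.eval (j : ℤ)) hQ
    have e2 := congrArg (Polynomial.eval (n : ℤ)) hQ'
    simp only [Polynomial.eval_comp, Polynomial.eval_add, Polynomial.eval_mul,
      Polynomial.eval_C, Polynomial.eval_X] at e1 e2
    have hpt : r + (d : ℤ) * j = r' + (q : ℤ) * d * n := by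
      rw [← hj]; linear_combination -hs
    rw [hpt, e2, mul_assoc] at e1
    exact (mul_left_cancel₀ hk'.ne' e1).symm
  unfold Iset at hy ⊢
  split_ifs at hy ⊢ with h₁ h₂ h₂
  · obtain ⟨n, hn, rfl, hpos⟩ := hy
    obtain ⟨j, hj, he⟩ := key n hn
    exact ⟨j, hj, he, mul_pos hm' hpos⟩
  · exact absurd (hsign.1 h₁) h₂
  · exact absurd (hsign.2 h₂) h₁
  · obtain ⟨n, hn, rfl, hneg⟩ := hy
    obtain ⟨j, hj, he⟩ := key n hn
    exact ⟨j, hj, he, mul_neg_of_pos_of_neg hm' hneg⟩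

/-- **Inheritance of the lack of polynomial differences (several polynomials).** -/
theorem inheritance_many
    (l : ℕ) (hl : 1 ≤ l) (Lam : ℕ) (hLam : 0 < Lam)
    (h : Fin l → Polynomial ℤ) (hne : ∀ i, h i ≠ 0)
    (d q lam : Fin l → ℕ) (hd : ∀ i, 0 < d i) (hq : ∀ i, 0 < q i) (hlam : ∀ i, 0 < lam i)
    (r r' : Fin l → ℤ)
    (hr1 : ∀ i, -((d i : ℤ)) < r i) (hr2 : ∀ i, r i ≤ 0)
    (hr1' : ∀ i, -((q i : ℤ) * (d i : ℤ)) < r' i) (hr2' : ∀ i, r' i ≤ 0)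
    (hdr : ∀ i, ((d i : ℤ)) ∣ (r' i - r i))
    (H H' : Fin l → Polynomial ℤ)
    (hH : ∀ i, (h i).comp (Polynomial.C (r i) + Polynomial.C ((d i : ℤ)) * Polynomial.X)
        = Polynomial.C ((lam i : ℤ)) * H i)
    (hH' : ∀ i, (h i).comp
          (Polynomial.C (r' i) + Polynomial.C ((q i : ℤ) * (d i : ℤ)) * Polynomial.X)
        = Polynomial.C ((lam i : ℤ) * (Lam : ℤ)) * H' i)
    (A : Set ℕ) (hA : diffSet A ∩ sumsetFam (fun i => Iset (H i)) ⊆ {0})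
    (x₀ : ℤ) (A' : Set ℕ)
    (hA' : A' ⊆ {a : ℕ | ∃ b ∈ A, (b : ℤ) = x₀ + (Lam : ℤ) * a}) :
    diffSet A' ∩ sumsetFam (fun i => Iset (H' i)) ⊆ {0} := by
  rintro x ⟨⟨a, ha, a', ha', hx⟩, f, hf, hsum⟩
  obtain ⟨b, hb, hba⟩ := hA' ha
  obtain ⟨b', hb', hba'⟩ := hA' ha'
  have hzero : (Lam : ℤ) * x ∈ ({0} : Set ℤ) := hA
    ⟨⟨b, hb, b', hb', by rw [hba, hba', ← hx]; ring⟩, fun i => (Lam : ℤ) * f i,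
      fun i => mul_mem_Iset_of_comp_linear_eq (hd i) (hq i) (hlam i) hLam (hr2 i) (hr1' i)
        (hdr i) (hH i) (hH' i) (hf i),
      by rw [hsum, Finset.mul_sum]⟩
  exact (mul_eq_zero.1 hzero).resolve_left (by exact_mod_cast hLam.ne')
end

section
/- Suppose g(x) = a_0 + a_1 x + ⋯ + a_k x^k ∈ ℤ[x] and q is a positive integer such that q ∣ g(n) for every integer n. Then q divides k! · gcd(a_0, a_1, …, a_k). -/
open Polynomial

/-- The top coefficient of a polynomial of degree at most `k` whose values are all divisible by `q`
becomes divisible by `q` after multiplication by `k!`. -/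
theorem dvd_factorial_mul_coeff_of_forall_dvd_eval {g : ℤ[X]} {k : ℕ} (hdeg : g.natDegree ≤ k)
    {q : ℤ} (hdvd : ∀ n : ℤ, q ∣ g.eval n) : q ∣ (k.factorial : ℤ) * g.coeff k := by
  rcases hdeg.lt_or_eq with h | rfl
  · simp [coeff_eq_zero_of_natDegree_lt h]
  · have h := congrFun g.fwdDiff_iter_degree_eq_factorial 0
    rw [fwdDiff_iter_eq_sum_shift] at h
    have h' : q ∣ (g.leadingCoeff • (g.natDegree.factorial : ℤ → ℤ)) 0 :=
      h ▸ Finset.dvd_sum fun i _ => by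
        rw [smul_eq_mul]
        exact (hdvd _).mul_left _
    simpa [mul_comm] using h'

/-- The product of `k` consecutive integers is divisible by `k!`. -/
theorem factorial_dvd_eval_descPochhammer (k : ℕ) (n : ℤ) :
    (k.factorial : ℤ) ∣ (descPochhammer ℤ k).eval n := by
  have h := Ring.descPochhammer_eq_factorial_smul_choose n k
  rw [← eval_eq_smeval, nsmul_eq_mul] at h
  exact Dvd.intro _ h.symm

/-- If all values of an integer polynomial of degree at most `k` are divisible by `q`, then `q`
divides `k!` times each of its coefficients. -/
theorem C_dvd_factorial_mul_of_forall_dvd_eval {k : ℕ} {g : ℤ[X]} (hdeg : g.natDegree ≤ k)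
    {q : ℤ} (hdvd : ∀ n : ℤ, q ∣ g.eval n) : C q ∣ C (k.factorial : ℤ) * g := by
  induction k generalizing g with
  | zero =>
    have h := dvd_factorial_mul_coeff_of_forall_dvd_eval hdeg hdvd
    rw [eq_C_of_natDegree_le_zero hdeg, ← C_mul]
    exact map_dvd C h
  | succ k ih =>
    have h := dvd_factorial_mul_coeff_of_forall_dvd_eval hdeg hdvd
    set a := g.coeff (k + 1) with ha
    set D := descPochhammer ℤ (k + 1)
    have hD : D.natDegree = k + 1 := descPochhammer_natDegree ℤ (k + 1)
    have hDc : D.coeff (k + 1) = 1 := by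
      have := monic_descPochhammer ℤ (k + 1)
      rwa [Monic, leadingCoeff, hD] at this
    have hdeg' : (g - C a * D).natDegree ≤ k := by
      refine natDegree_le_iff_coeff_eq_zero.2 fun N hN => ?_
      rw [coeff_sub, coeff_C_mul]
      rcases (Nat.succ_le_of_lt hN).eq_or_lt with rfl | hN'
      · simp [hDc, ha]
      · rw [coeff_eq_zero_of_natDegree_lt (hdeg.trans_lt hN'),
          coeff_eq_zero_of_natDegree_lt (hD.trans_lt hN')]
        simp
    have hr := ih hdeg' fun n => by
      rw [eval_sub, eval_mul, eval_C]
      refine (hdvd n).sub (h.trans ?_)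
      rw [mul_comm]
      exact mul_dvd_mul_left a (factorial_dvd_eval_descPochhammer (k + 1) n)
    have hsplit : C ((k + 1).factorial : ℤ) * g =
        C ((k + 1 : ℕ) : ℤ) * (C (k.factorial : ℤ) * (g - C a * D)) +
          C (((k + 1).factorial : ℤ) * a) * D := by
      rw [Nat.factorial_succ, Nat.cast_mul, C_mul, C_mul, C_mul]
      ring
    rw [hsplit]
    exact (hr.mul_left _).add ((map_dvd C h).mul_right _)

/-- If `g = a_0 + a_1 x + ⋯ + a_k x^k ∈ ℤ[x]` is identically zero modulo `q`, then
`q ∣ k! · gcd(a_0, …, a_k)`. -/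
theorem identically_zero_mod_divides
    (g : Polynomial ℤ) (k : ℕ) (hdeg : g.natDegree ≤ k)
    (q : ℕ) (hq : 0 < q) (hdvd : ∀ n : ℤ, (q : ℤ) ∣ g.eval n) :
    (q : ℤ) ∣ (Nat.factorial k : ℤ) * (Finset.range (k + 1)).gcd (fun i => g.coeff i) := by
  have h := C_dvd_factorial_mul_of_forall_dvd_eval hdeg hdvd
  rw [← content_eq_gcd_range_of_lt g (k + 1) (Nat.lt_succ_of_le hdeg)]
  rw [← dvd_content_iff_C_dvd, content_C_mul,
    Int.normalize_of_nonneg (Int.natCast_nonneg _)] at h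
  exact h
end
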